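/- arXiv:2306.03338 — 3 statements merged into one kernel-verified Lean document; each statement's English description precedes it below -/
import Mathlib

section
/- Let s and t be coprime positive integers and n, m integers with 0 < n < s and 0 < m < t. For every τ ∈ ℂ with Im τ > 0 (writing q^x := exp(2πiτx) for x ∈ ℝ), one has lim_{N→∞} ( q^{((nt)²+(ms)²)/(4st) − N/2} · 𝒥_N(q) − N · Φ_{s,t}^{(n,m)}(τ) ) = Σ_{k∈ℤ} |k| ( q^{(2stk−nt−ms)²/(4st)} − q^{(2stk−nt+ms)²/(4st)} ), where the series on the right converges absolutely. (This is the main theorem: the tail of the N-colored Jones polynomial of the torus link T_{2s,2t} equals η(τ)·ch_q(𝒳_{n,m}^+)^{h=0}, the singlet character of the (s,t)-log VOA.) -/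
open Complex Filter Finset

/-- `Q τ x = q^x = exp(2πiτx)` for real `x`. -/
noncomputable def Q (τ : ℂ) (x : ℝ) : ℂ := Complex.exp (2 * Real.pi * Complex.I * τ * x)

/-- The 2st-periodic function `χ_{2st}^{(n,m)}`. -/
def chi (s t n m k : ℤ) : ℤ :=
  if k ≡ n * t - m * s [ZMOD 2 * s * t] ∨ k ≡ -(n * t - m * s) [ZMOD 2 * s * t] then 1
  else if k ≡ n * t + m * s [ZMOD 2 * s * t] ∨ k ≡ -(n * t + m * s) [ZMOD 2 * s * t] then -1
  else 0

/-- The theta series `Φ_{s,t}^{(n,m)}(τ)`. -/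
noncomputable def Phi (s t n m : ℤ) (τ : ℂ) : ℂ :=
  (1 / 2) * ∑' k : ℤ, (chi s t n m k : ℂ) * Q τ ((k : ℝ) ^ 2 / (4 * s * t))

/-- The family `𝒥_N(q; (n,m), 2s, 2t)` of colored Jones polynomials of `T_{2s,2t}`. -/
noncomputable def J (s t n m : ℤ) (N : ℕ) (τ : ℂ) : ℂ :=
  (Q τ ((N : ℝ) / 2) - Q τ (-((N : ℝ) / 2)))⁻¹ *
    ∑ c ∈ Finset.range N, ∑ r ∈ Finset.Icc (-(c : ℤ)) (c : ℤ),
      (Q τ (((s * t * r ^ 2 - (n * t + m * s) * r : ℤ) : ℝ) + ((m * n : ℤ) : ℝ) / 2)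
        - Q τ (((s * t * r ^ 2 + (n * t - m * s) * r : ℤ) : ℝ) - ((m * n : ℤ) : ℝ) / 2))

noncomputable def FF (s t : ℤ) (τ : ℂ) (a k : ℤ) : ℂ :=
  Q τ (((2 * s * t * k - a : ℤ) : ℝ) ^ 2 / (4 * s * t))

lemma hasSum_congr_aux {f g : ℤ → ℂ} {a : ℂ} (h : ∀ k, f k = g k) :
    HasSum f a ↔ HasSum g a := by
  rw [funext h]

lemma Q_add (τ : ℂ) (x y : ℝ) : Q τ (x + y) = Q τ x * Q τ y := by
  unfold Q
  rw [← Complex.exp_add]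
  congr 1
  push_cast
  ring

lemma norm_Q (τ : ℂ) (x : ℝ) : ‖Q τ x‖ = Real.exp (-(2 * Real.pi * τ.im * x)) := by
  unfold Q
  rw [Complex.norm_exp]
  congr 1
  simp

lemma FF_bound (s t : ℤ) (hs : 0 < s) (ht : 0 < t) (τ : ℂ) (hτ : 0 < τ.im) (a k : ℤ) :
    ‖FF s t τ a k‖ ≤ Real.exp (-Real.pi * ((τ.im * (2 * s * t)) * k ^ 2
      - 2 * (τ.im * |(a : ℝ)|) * |k|)) := by
  unfold FF
  rw [norm_Q]
  apply Real.exp_le_exp.2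
  have hs' : (0 : ℝ) < s := by exact_mod_cast hs
  have ht' : (0 : ℝ) < t := by exact_mod_cast ht
  have h1 : (a : ℝ) * k ≤ |(a : ℝ)| * |(k : ℝ)| := by
    rw [← abs_mul]; exact le_abs_self _
  have h2 : (((2 * s * t * k - a : ℤ) : ℝ) ^ 2 / (4 * s * t))
      = s * t * k ^ 2 - a * k + a ^ 2 / (4 * s * t) := by
    push_cast
    field_simp
    ring
  have h3 : (0 : ℝ) ≤ (a : ℝ) ^ 2 / (4 * s * t) := by positivity
  have h4 : (s * t * k ^ 2 : ℝ) - |(a : ℝ)| * |(k : ℝ)|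
      ≤ s * t * k ^ 2 - a * k + a ^ 2 / (4 * s * t) := by linarith
  rw [h2]
  have h5 : 0 < 2 * Real.pi * τ.im := by positivity
  have := mul_le_mul_of_nonneg_left h4 h5.le
  push_cast
  linarith

lemma FF_summable_abs (s t : ℤ) (hs : 0 < s) (ht : 0 < t) (τ : ℂ) (hτ : 0 < τ.im) (a : ℤ) :
    Summable (fun k : ℤ => |(k : ℝ)| * ‖FF s t τ a k‖) := by
  have hs' : (0 : ℝ) < s := by exact_mod_cast hs
  have ht' : (0 : ℝ) < t := by exact_mod_cast ht
  have := summable_pow_mul_jacobiTheta₂_term_bound (τ.im * |(a : ℝ)|)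
    (T := τ.im * (2 * s * t)) (by positivity) 1
  refine Summable.of_nonneg_of_le (fun k => by positivity) (fun k => ?_) this
  have := FF_bound s t hs ht τ hτ a k
  simp only [pow_one, Int.cast_abs] at this ⊢
  gcongr

lemma FF_summable (s t : ℤ) (hs : 0 < s) (ht : 0 < t) (τ : ℂ) (hτ : 0 < τ.im) (a : ℤ) :
    Summable (fun k : ℤ => FF s t τ a k) := by
  have hs' : (0 : ℝ) < s := by exact_mod_cast hs
  have ht' : (0 : ℝ) < t := by exact_mod_cast ht
  have := summable_pow_mul_jacobiTheta₂_term_bound (τ.im * |(a : ℝ)|)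
    (T := τ.im * (2 * s * t)) (by positivity) 0
  refine Summable.of_norm_bounded this (fun k => ?_)
  have := FF_bound s t hs ht τ hτ a k
  simpa using this

lemma FF_neg (s t : ℤ) (τ : ℂ) (a k : ℤ) : FF s t τ a (-k) = FF s t τ (-a) k := by
  unfold FF
  congr 2
  push_cast
  ring

lemma tsum_FF_neg (s t : ℤ) (τ : ℂ) (a : ℤ) :
    ∑' k : ℤ, FF s t τ (-a) k = ∑' k : ℤ, FF s t τ a k := by
  rw [← (Equiv.neg ℤ).tsum_eq (fun k => FF s t τ a k)]
  simp [FF_neg]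

lemma hasSum_class (s t : ℤ) (hs : 0 < s) (ht : 0 < t) (τ : ℂ) (hτ : 0 < τ.im) (a : ℤ) :
    HasSum (fun k : ℤ => (if k ≡ a [ZMOD 2 * s * t] then (1 : ℂ) else 0)
      * Q τ ((k : ℝ) ^ 2 / (4 * s * t))) (∑' k : ℤ, FF s t τ a k) := by
  have hD : 0 < 2 * s * t := by positivity
  have hinj : Function.Injective (fun j : ℤ => 2 * s * t * j + a) := by
    intro i j hij
    have : 2 * s * t * i = 2 * s * t * j := by simpa using hij
    exact mul_left_cancel₀ hD.ne' this
  rw [← hinj.hasSum_iff]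
  · rw [← tsum_FF_neg]
    have := (FF_summable s t hs ht τ hτ (-a)).hasSum
    convert this using 2 with k
    simp [FF, Int.ModEq]
  · intro x hx
    rw [if_neg, zero_mul]
    intro h
    apply hx
    obtain ⟨c, hc⟩ := h.symm.dvd
    exact ⟨c, by simp only; linarith⟩

lemma chi_eq (s t n m : ℤ) (hs : 0 < s) (ht : 0 < t) (hst : IsCoprime s t)
    (hn : 0 < n) (hns : n < s) (hm : 0 < m) (hmt : m < t) (k : ℤ) :
    (chi s t n m k : ℂ) = (if k ≡ n * t - m * s [ZMOD 2 * s * t] then (1 : ℂ) else 0)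
      + (if k ≡ -(n * t - m * s) [ZMOD 2 * s * t] then (1 : ℂ) else 0)
      - (if k ≡ n * t + m * s [ZMOD 2 * s * t] then (1 : ℂ) else 0)
      - (if k ≡ -(n * t + m * s) [ZMOD 2 * s * t] then (1 : ℂ) else 0) := by
  have key1 : ∀ c : ℤ, ¬ (s ∣ n * t + s * c) := by
    intro c h
    have h1 : s ∣ n * t := (Int.dvd_add_left (dvd_mul_right s c)).1 h
    have h2 : s ∣ n := hst.dvd_of_dvd_mul_right h1
    exact absurd (Int.le_of_dvd hn h2) (by omega)
  have key2 : ¬ (t ∣ m * s) := by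
    intro h1
    have h2 : t ∣ m := hst.symm.dvd_of_dvd_mul_right h1
    exact absurd (Int.le_of_dvd hm h2) (by omega)
  -- a class cannot be two different ones
  have d12 : k ≡ n * t - m * s [ZMOD 2 * s * t] → ¬ k ≡ -(n * t - m * s) [ZMOD 2 * s * t] := by
    intro h1 h2
    obtain ⟨c, hc⟩ := (h2.symm.trans h1).dvd
    apply key1 (-m)
    exact ⟨t * c, by linarith⟩
  have d34 : k ≡ n * t + m * s [ZMOD 2 * s * t] → ¬ k ≡ -(n * t + m * s) [ZMOD 2 * s * t] := by
    intro h1 h2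
    obtain ⟨c, hc⟩ := (h2.symm.trans h1).dvd
    apply key1 m
    exact ⟨t * c, by linarith⟩
  have d13 : k ≡ n * t - m * s [ZMOD 2 * s * t] → ¬ k ≡ n * t + m * s [ZMOD 2 * s * t] := by
    intro h1 h2
    obtain ⟨c, hc⟩ := (h1.symm.trans h2).dvd
    exact key2 ⟨s * c, by linarith⟩
  have d14 : k ≡ n * t - m * s [ZMOD 2 * s * t] → ¬ k ≡ -(n * t + m * s) [ZMOD 2 * s * t] := by
    intro h1 h2
    obtain ⟨c, hc⟩ := (h2.symm.trans h1).dvd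
    exact key1 0 ⟨t * c, by linarith⟩
  have d23 : k ≡ -(n * t - m * s) [ZMOD 2 * s * t] → ¬ k ≡ n * t + m * s [ZMOD 2 * s * t] := by
    intro h1 h2
    obtain ⟨c, hc⟩ := (h1.symm.trans h2).dvd
    exact key1 0 ⟨t * c, by linarith⟩
  have d24 : k ≡ -(n * t - m * s) [ZMOD 2 * s * t] → ¬ k ≡ -(n * t + m * s) [ZMOD 2 * s * t] := by
    intro h1 h2
    obtain ⟨c, hc⟩ := (h2.symm.trans h1).dvd
    exact key2 ⟨s * c, by linarith⟩
  unfold chi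
  by_cases h1 : k ≡ n * t - m * s [ZMOD 2 * s * t]
  · simp only [h1, d12 h1, d13 h1, d14 h1]; simp
  by_cases h2 : k ≡ -(n * t - m * s) [ZMOD 2 * s * t]
  · simp only [h1, h2, d23 h2, d24 h2]; simp
  by_cases h3 : k ≡ n * t + m * s [ZMOD 2 * s * t]
  · simp only [h1, h2, h3, d34 h3]; simp
  by_cases h4 : k ≡ -(n * t + m * s) [ZMOD 2 * s * t]
  · simp only [h1, h2, h3, h4]; simp
  simp only [h1, h2, h3, h4]; simp

lemma Phi_eq (s t n m : ℤ) (hs : 0 < s) (ht : 0 < t) (hst : IsCoprime s t)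
    (hn : 0 < n) (hns : n < s) (hm : 0 < m) (hmt : m < t) (τ : ℂ) (hτ : 0 < τ.im) :
    Phi s t n m τ = -∑' k : ℤ, (FF s t τ (n * t + m * s) k - FF s t τ (n * t - m * s) k) := by
  have H := (((hasSum_class s t hs ht τ hτ (n * t - m * s)).add
    (hasSum_class s t hs ht τ hτ (-(n * t - m * s)))).sub
    (hasSum_class s t hs ht τ hτ (n * t + m * s))).sub
    (hasSum_class s t hs ht τ hτ (-(n * t + m * s)))
  unfold Phi
  have H' := (hasSum_congr_aux
    (f := fun k : ℤ => (chi s t n m k : ℂ) * Q τ ((k : ℝ) ^ 2 / (4 * s * t))) (fun k => by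
    rw [chi_eq s t n m hs ht hst hn hns hm hmt, sub_mul, sub_mul, add_mul])).mpr H
  rw [H'.tsum_eq, tsum_FF_neg, tsum_FF_neg,
    (FF_summable s t hs ht τ hτ _).tsum_sub (FF_summable s t hs ht τ hτ _)]
  ring

lemma double_sum (h : ℤ → ℂ) (hh : Summable h) (N : ℕ) :
    HasSum (fun k : ℤ => ((min |k| (N : ℤ) : ℤ) : ℂ) * h k)
      ((N : ℂ) * (∑' k, h k) - ∑ c ∈ Finset.range N, ∑ r ∈ Finset.Icc (-(c : ℤ)) (c : ℤ), h r) := by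
  induction N with
  | zero =>
    simp only [Nat.cast_zero, zero_mul, Finset.range_zero, Finset.sum_empty, sub_zero]
    convert (hasSum_zero : HasSum (fun _ : ℤ => (0 : ℂ)) 0) using 2 with k
    rw [min_eq_right (abs_nonneg k)]; simp
  | succ N ih =>
    have h1 : HasSum (fun k : ℤ => if k ∈ Finset.Icc (-(N : ℤ)) (N : ℤ) then h k else 0)
        (∑ r ∈ Finset.Icc (-(N : ℤ)) (N : ℤ), h r) := by
      rw [Finset.sum_congr rfl (g := fun k => if k ∈ Finset.Icc (-(N : ℤ)) (N : ℤ) then h k else 0)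
        (fun x hx => by simp only [hx, if_true])]
      exact hasSum_sum_of_ne_finset_zero (fun b hb => by simp only [hb, if_false])
    have H := (ih.add hh.hasSum).sub h1
    have e : ((N + 1 : ℕ) : ℂ) * (∑' k, h k)
        - ∑ c ∈ Finset.range (N + 1), ∑ r ∈ Finset.Icc (-(c : ℤ)) (c : ℤ), h r
        = (N : ℂ) * (∑' k, h k) - ∑ c ∈ Finset.range N, ∑ r ∈ Finset.Icc (-(c : ℤ)) (c : ℤ), h r
          + (∑' k, h k) - ∑ r ∈ Finset.Icc (-(N : ℤ)) (N : ℤ), h r := by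
      rw [Finset.sum_range_succ]
      push_cast
      ring
    rw [e]
    refine (hasSum_congr_aux fun k => ?_).mpr H
    by_cases hk : k ∈ Finset.Icc (-(N : ℤ)) (N : ℤ)
    · simp only [hk, if_true]
      have : |k| ≤ N := abs_le.2 (Finset.mem_Icc.1 hk)
      rw [min_eq_left this, min_eq_left (by push_cast; linarith)]
      ring
    · simp only [hk, if_false]
      have : (N : ℤ) < |k| := by
        by_contra hc
        exact hk (Finset.mem_Icc.2 (abs_le.1 (not_lt.1 hc)))
      rw [min_eq_right this.le, min_eq_right (by push_cast; linarith)]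
      push_cast
      ring

lemma term_eq (s t n m : ℤ) (hs : 0 < s) (ht : 0 < t) (τ : ℂ) (N : ℕ) :
    Q τ ((((n * t) ^ 2 + (m * s) ^ 2 : ℤ) : ℝ) / (4 * s * t)) *
    ∑ c ∈ Finset.range N, ∑ r ∈ Finset.Icc (-(c : ℤ)) (c : ℤ),
      (Q τ (((s * t * r ^ 2 - (n * t + m * s) * r : ℤ) : ℝ) + ((m * n : ℤ) : ℝ) / 2)
        - Q τ (((s * t * r ^ 2 + (n * t - m * s) * r : ℤ) : ℝ) - ((m * n : ℤ) : ℝ) / 2))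
    = ∑ c ∈ Finset.range N, ∑ r ∈ Finset.Icc (-(c : ℤ)) (c : ℤ),
      (FF s t τ (n * t + m * s) r - FF s t τ (n * t - m * s) r) := by
  have hs' : (s : ℝ) ≠ 0 := by exact_mod_cast hs.ne'
  have ht' : (t : ℝ) ≠ 0 := by exact_mod_cast ht.ne'
  rw [Finset.mul_sum]
  refine Finset.sum_congr rfl fun c _ => ?_
  rw [Finset.mul_sum]
  have e : ∀ r : ℤ, Q τ ((((n * t) ^ 2 + (m * s) ^ 2 : ℤ) : ℝ) / (4 * s * t)) *
      (Q τ (((s * t * r ^ 2 - (n * t + m * s) * r : ℤ) : ℝ) + ((m * n : ℤ) : ℝ) / 2)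
        - Q τ (((s * t * r ^ 2 + (n * t - m * s) * r : ℤ) : ℝ) - ((m * n : ℤ) : ℝ) / 2))
      = FF s t τ (n * t + m * s) r - FF s t τ (n * t - m * s) (-r) := by
    intro r
    rw [mul_sub, ← Q_add, ← Q_add]
    unfold FF
    congr 2
    · push_cast
      field_simp
      ring
    · push_cast
      field_simp
      ring
  simp only [e]
  rw [Finset.sum_sub_distrib, Finset.sum_sub_distrib]
  congr 1
  refine Finset.sum_nbij' (fun r => -r) (fun r => -r) ?_ ?_ ?_ ?_ ?_
  · intro r hr; rw [Finset.mem_Icc] at *; omega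
  · intro r hr; rw [Finset.mem_Icc] at *; omega
  · simp
  · simp
  · simp

lemma Q_nat (τ : ℂ) (N : ℕ) : Q τ N = Q τ 1 ^ N := by
  unfold Q
  rw [← Complex.exp_nat_mul]
  congr 1
  push_cast
  ring

theorem statement0 (s t n m : ℤ) (hs : 0 < s) (ht : 0 < t) (hst : IsCoprime s t)
    (hn : 0 < n) (hns : n < s) (hm : 0 < m) (hmt : m < t)
    (τ : ℂ) (hτ : 0 < τ.im) :
    Summable (fun k : ℤ => ((|k| : ℤ) : ℂ) *
      (Q τ (((2 * s * t * k - n * t - m * s : ℤ) : ℝ) ^ 2 / (4 * s * t))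
        - Q τ (((2 * s * t * k - n * t + m * s : ℤ) : ℝ) ^ 2 / (4 * s * t)))) ∧
    Tendsto (fun N : ℕ =>
        Q τ ((((n * t) ^ 2 + (m * s) ^ 2 : ℤ) : ℝ) / (4 * s * t) - (N : ℝ) / 2) * J s t n m N τ
          - (N : ℂ) * Phi s t n m τ)
      atTop
      (nhds (∑' k : ℤ, ((|k| : ℤ) : ℂ) *
        (Q τ (((2 * s * t * k - n * t - m * s : ℤ) : ℝ) ^ 2 / (4 * s * t))
          - Q τ (((2 * s * t * k - n * t + m * s : ℤ) : ℝ) ^ 2 / (4 * s * t))))) := by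
  have hs' : (0 : ℝ) < s := by exact_mod_cast hs
  have ht' : (0 : ℝ) < t := by exact_mod_cast ht
  set h : ℤ → ℂ := fun k => FF s t τ (n * t + m * s) k - FF s t τ (n * t - m * s) k with hh
  have hfun : (fun k : ℤ => ((|k| : ℤ) : ℂ) *
      (Q τ (((2 * s * t * k - n * t - m * s : ℤ) : ℝ) ^ 2 / (4 * s * t))
        - Q τ (((2 * s * t * k - n * t + m * s : ℤ) : ℝ) ^ 2 / (4 * s * t))))
      = fun k : ℤ => ((|k| : ℤ) : ℂ) * h k := by
    funext k
    simp only [hh, FF]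
    rw [show 2 * s * t * k - n * t - m * s = 2 * s * t * k - (n * t + m * s) by ring,
      show 2 * s * t * k - n * t + m * s = 2 * s * t * k - (n * t - m * s) by ring]
  rw [hfun]
  have hsum : Summable h := (FF_summable s t hs ht τ hτ _).sub (FF_summable s t hs ht τ hτ _)
  have hbsum : Summable (fun k : ℤ => |(k : ℝ)| * ‖h k‖) := by
    refine Summable.of_nonneg_of_le (fun k => by positivity) (fun k => ?_)
      ((FF_summable_abs s t hs ht τ hτ (n * t + m * s)).add
        (FF_summable_abs s t hs ht τ hτ (n * t - m * s)))
    rw [← mul_add]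
    exact mul_le_mul_of_nonneg_left (norm_sub_le _ _) (abs_nonneg _)
  refine ⟨Summable.of_norm_bounded hbsum fun k => ?_, ?_⟩
  · rw [norm_mul, Complex.norm_intCast]
    simp
  have hM : Tendsto (fun N : ℕ => ∑' k : ℤ, ((min |k| (N : ℤ) : ℤ) : ℂ) * h k) atTop
      (nhds (∑' k : ℤ, ((|k| : ℤ) : ℂ) * h k)) := by
    refine tendsto_tsum_of_dominated_convergence hbsum (fun k => ?_) (Eventually.of_forall ?_)
    · refine tendsto_const_nhds.congr' ?_
      filter_upwards [eventually_ge_atTop k.natAbs] with N hN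
      rw [min_eq_left (by rw [Int.abs_eq_natAbs]; omega)]
    · intro N k
      rw [norm_mul, Complex.norm_intCast]
      refine mul_le_mul_of_nonneg_right ?_ (norm_nonneg _)
      rw [← Int.cast_abs, ← Int.cast_abs, Int.cast_le,
        abs_of_nonneg (le_min (abs_nonneg k) (Int.natCast_nonneg N))]
      exact min_le_left _ _
  have hq : ‖Q τ 1‖ < 1 := by
    rw [norm_Q, Real.exp_lt_one_iff]
    have : 0 < 2 * Real.pi * τ.im * 1 := by positivity
    linarith
  have hqN := tendsto_pow_atTop_nhds_zero_of_norm_lt_one hq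
  have hNqN : Tendsto (fun N : ℕ => (N : ℂ) * Q τ 1 ^ N) atTop (nhds 0) :=
    by
    simpa using (summable_pow_mul_geometric_of_norm_lt_one 1 hq).tendsto_atTop_zero
  have h1q : Tendsto (fun N : ℕ => (1 - Q τ 1 ^ N)) atTop (nhds 1) := by
    simpa using hqN.const_sub 1
  have hlim := (hM.sub (hNqN.mul_const (∑' k, h k))).div h1q one_ne_zero
  rw [zero_mul, sub_zero, div_one] at hlim
  refine hlim.congr' ?_
  filter_upwards [eventually_ge_atTop 1] with N hN
  have hne : 1 - Q τ 1 ^ N ≠ 0 := by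
    intro h0
    have h2 : ‖Q τ 1 ^ N‖ = 1 := by rw [← sub_eq_zero.1 h0, norm_one]
    rw [norm_pow] at h2
    have := pow_lt_one₀ (norm_nonneg _) hq (by omega : N ≠ 0)
    linarith
  have hpos : Q τ ((N : ℝ) / 2) = Q τ 1 ^ N * Q τ (-((N : ℝ) / 2)) := by
    rw [← Q_nat, ← Q_add]; congr 1; ring
  have hz : Q τ (-((N : ℝ) / 2)) ≠ 0 := Complex.exp_ne_zero _
  simp only [Pi.div_apply]
  rw [(double_sum h hsum N).tsum_eq, Phi_eq s t n m hs ht hst hn hns hm hmt τ hτ]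
  unfold J
  rw [sub_eq_add_neg (_ / _) ((N : ℝ) / 2), Q_add, hpos, ← term_eq s t n m hs ht τ N]
  have hd : Q τ 1 ^ N * Q τ (-((N : ℝ) / 2)) - Q τ (-((N : ℝ) / 2))
      = -((1 - Q τ 1 ^ N) * Q τ (-((N : ℝ) / 2))) := by ring
  rw [hd]
  generalize (∑ c ∈ Finset.range N, _ : ℂ) = X
  generalize Q τ (-((N : ℝ) / 2)) = z at *
  generalize Q τ 1 ^ N = w at *
  rw [← hh]
  field_simp
  ring
end

section
/- Let s and t be coprime positive integers and n, m integers with 0 < n < s and 0 < m < t. For every positive integer N the radial limit lim_{ε→0⁺} ( −(1/2) Σ_{k=0}^{∞} k·χ(k)·exp( 2πi(1/N + iε)·k²/(4st) ) ) exists and equals (stN/2) · Σ_{k=1}^{2stN} χ(k) · exp( πik²/(2stN) ) · B₂( k/(2stN) ). (That is, the Eichler integral Φ̃_{s,t}^{(n,m)}(τ) = −(1/2) Σ_{k≥0} k χ(k) q^{k²/(4st)} has the stated limiting value at τ = 1/N.) -/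
open Complex Finset Filter

lemma aux_antidiff (M : ℕ) (hM : 0 < M) (f : ℕ → ℂ) (hp : ∀ k, f (k + M) = f k)
    (h0 : ∑ k ∈ range M, f k = 0) :
    ∃ F : ℕ → ℂ, (∀ k, F (k + M) = F k) ∧ (∑ k ∈ range M, F k = 0) ∧
      ∀ k, F (k + 1) - F k = f k := by
  have hM' : (M : ℂ) ≠ 0 := by exact_mod_cast hM.ne'
  refine ⟨fun k => ∑ j ∈ range k, f j - (∑ i ∈ range M, ∑ j ∈ range i, f j) / M, ?_, ?_, ?_⟩
  · intro k
    simp only [sub_left_inj]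
    rw [add_comm, Finset.sum_range_add, h0, zero_add]
    exact Finset.sum_congr rfl fun j _ => by rw [add_comm, hp]
  · rw [Finset.sum_sub_distrib]
    simp
    field_simp
    simp
  · intro k
    simp [Finset.sum_range_succ]

lemma aux_shift (M : ℕ) (F : ℕ → ℂ) (hp : ∀ k, F (k + M) = F k)
    (h0 : ∑ k ∈ range M, F k = 0) : ∑ k ∈ range M, F (k + 1) = 0 := by
  have h1 := Finset.sum_range_succ F M
  rw [Finset.sum_range_succ'] at h1
  have := hp 0
  rw [zero_add] at this
  rw [h0, this] at h1
  simpa using h1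

lemma aux_bdd (M : ℕ) (hM : 0 < M) (F : ℕ → ℂ) (hp : ∀ k, F (k + M) = F k) :
    ∃ C, ∀ k, ‖F k‖ ≤ C := by
  refine ⟨∑ k ∈ range M, ‖F k‖, fun k => ?_⟩
  have : F k = F (k % M) := (Function.Periodic.map_mod_nat (f := F) hp k).symm
  rw [this]
  exact Finset.single_le_sum (f := fun k => ‖F k‖) (fun i _ => norm_nonneg _)
    (Finset.mem_range.2 (Nat.mod_lt _ hM))

lemma aux_summ (F a : ℕ → ℂ) (C : ℝ) (hC : ∀ k, ‖F k‖ ≤ C) (ha : Summable fun k => ‖a k‖) :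
    Summable fun k => F k * a k := by
  refine Summable.of_norm_bounded (ha.mul_left C) fun k => ?_
  rw [norm_mul]
  exact mul_le_mul_of_nonneg_right (hC k) (norm_nonneg _)

lemma aux_parts (F a : ℕ → ℂ) (C : ℝ) (hC : ∀ k, ‖F k‖ ≤ C) (ha : Summable fun k => ‖a k‖) :
    ∑' k, (F (k + 1) - F k) * a k = -F 0 * a 0 + ∑' k, F (k + 1) * (a k - a (k + 1)) := by
  have h1 := aux_summ F a C hC ha
  have h2 := aux_summ (fun k => F (k + 1)) a C (fun k => hC _) ha
  have h3 : Summable fun k => F (k + 1) * a (k + 1) := (summable_nat_add_iff 1).2 h1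
  simp only [sub_mul, mul_sub]
  rw [h2.tsum_sub h1, h2.tsum_sub h3, h1.tsum_eq_zero_add]
  ring

lemma aux_dsumm (a : ℕ → ℂ) (ha : Summable fun k => ‖a k‖) :
    Summable fun k => ‖a k - a (k + 1)‖ :=
  Summable.of_nonneg_of_le (fun _ => norm_nonneg _) (fun _ => norm_sub_le _ _)
    (ha.add ((summable_nat_add_iff 1).2 ha))

lemma aux_mvt (h h' : ℝ → ℝ) (k K : ℝ) (hd : ∀ x, HasDerivAt h (h' x) x)
    (hb : ∀ x, k ≤ x → |h' x| ≤ K) : ∀ x, k ≤ x → |h x - h (x + 1)| ≤ K := by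
  intro x hx
  obtain ⟨c, hc, hc'⟩ := exists_hasDerivAt_eq_slope h h' (show x < x + 1 by linarith)
    (fun y _ => (hd y).continuousAt.continuousWithinAt) (fun y _ => hd y)
  have : h x - h (x + 1) = - h' c := by rw [hc']; ring
  rw [this, abs_neg]
  exact hb c (hx.trans hc.1.le)

/-- The Gaussian test function. -/
noncomputable def gaF (d x : ℝ) : ℝ := x * Real.exp (-d * x ^ 2)

lemma aux_exp (d x : ℝ) :
    HasDerivAt (fun x => Real.exp (-d * x ^ 2)) (-2 * d * x * Real.exp (-d * x ^ 2)) x := by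
  have := ((hasDerivAt_pow 2 x).const_mul (-d)).exp
  convert this using 1
  simp; ring

lemma aux_d1 (d x : ℝ) :
    HasDerivAt (gaF d) ((1 - 2 * d * x ^ 2) * Real.exp (-d * x ^ 2)) x := by
  have := (hasDerivAt_id x).mul (aux_exp d x)
  refine HasDerivAt.congr_deriv this ?_
  simp
  ring

lemma aux_d2 (d x : ℝ) :
    HasDerivAt (fun x => (1 - 2 * d * x ^ 2) * Real.exp (-d * x ^ 2))
      ((-6 * d * x + 4 * d ^ 2 * x ^ 3) * Real.exp (-d * x ^ 2)) x := by
  have := (((hasDerivAt_pow 2 x).const_mul (2 * d)).const_sub 1).mul (aux_exp d x)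
  refine HasDerivAt.congr_deriv this ?_
  simp
  ring

lemma aux_d3 (d x : ℝ) :
    HasDerivAt (fun x => (-6 * d * x + 4 * d ^ 2 * x ^ 3) * Real.exp (-d * x ^ 2))
      ((-6 * d + 24 * d ^ 2 * x ^ 2 - 8 * d ^ 3 * x ^ 4) * Real.exp (-d * x ^ 2)) x := by
  have := (((hasDerivAt_id x).const_mul (-6 * d)).add
    ((hasDerivAt_pow 3 x).const_mul (4 * d ^ 2))).mul (aux_exp d x)
  refine HasDerivAt.congr_deriv this ?_
  simp
  ring

lemma aux_d3_bound (d k : ℝ) (hd : 0 < d) (hk : 0 < k) (x : ℝ) (hx : k ≤ x) :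
    |(-6 * d + 24 * d ^ 2 * x ^ 2 - 8 * d ^ 3 * x ^ 4) * Real.exp (-d * x ^ 2)|
      ≤ 102 / k ^ 2 := by
  have hx0 : 0 < x := hk.trans_le hx
  have h : |(-6 * d + 24 * d ^ 2 * x ^ 2 - 8 * d ^ 3 * x ^ 4) * Real.exp (-d * x ^ 2)|
      ≤ 102 / x ^ 2 := by
    rw [le_div_iff₀ (by positivity), abs_mul, abs_of_pos (Real.exp_pos _)]
    set y := d * x ^ 2 with hy
    have hy0 : 0 ≤ y := by positivity
    have e1 := Real.pow_div_factorial_le_exp y hy0 1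
    have e2 := Real.pow_div_factorial_le_exp y hy0 2
    have e3 := Real.pow_div_factorial_le_exp y hy0 3
    simp [Nat.factorial] at e1 e2 e3
    have hexp : Real.exp (-d * x ^ 2) = (Real.exp y)⁻¹ := by
      rw [← Real.exp_neg, hy]; congr 1; ring
    have hab : |-6 * d + 24 * d ^ 2 * x ^ 2 - 8 * d ^ 3 * x ^ 4| ≤
        6 * d + 24 * d ^ 2 * x ^ 2 + 8 * d ^ 3 * x ^ 4 := by
      have p1 : 0 ≤ d ^ 2 * x ^ 2 := by positivity
      have p2 : 0 ≤ d ^ 3 * x ^ 4 := by positivity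
      rw [abs_le]
      constructor <;> linarith
    have hE := Real.exp_pos y
    rw [hexp]
    calc |-6 * d + 24 * d ^ 2 * x ^ 2 - 8 * d ^ 3 * x ^ 4| * (Real.exp y)⁻¹ * x ^ 2
        ≤ (6 * d + 24 * d ^ 2 * x ^ 2 + 8 * d ^ 3 * x ^ 4) * (Real.exp y)⁻¹ * x ^ 2 := by gcongr
      _ = (6 * y + 24 * y ^ 2 + 8 * y ^ 3) / Real.exp y := by rw [hy]; ring
      _ ≤ 102 := by
        rw [div_le_iff₀ hE]
        linarith
  refine h.trans ?_
  gcongr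

lemma aux_D3 (d : ℝ) (hd : 0 < d) (k : ℝ) (hk : 0 < k) :
    |((gaF d k - gaF d (k + 1)) - (gaF d (k + 1) - gaF d (k + 1 + 1)))
      - ((gaF d (k + 1) - gaF d (k + 1 + 1)) - (gaF d (k + 1 + 1) - gaF d (k + 1 + 1 + 1)))|
      ≤ 102 / k ^ 2 := by
  have s1 := aux_mvt _ _ k _ (aux_d3 d) (aux_d3_bound d k hd hk)
  have s2 := aux_mvt _ _ k _ (fun x => (aux_d2 d x).sub ((aux_d2 d (x + 1)).comp_add_const x 1)) s1
  have s3 := aux_mvt _ _ k _ (fun x => ((aux_d1 d x).sub ((aux_d1 d (x + 1)).comp_add_const x 1)).sub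
    (((aux_d1 d (x + 1)).sub ((aux_d1 d (x + 1 + 1)).comp_add_const (x + 1) 1)).comp_add_const x 1)) s2
  exact s3 k le_rfl

lemma aux_gsumm (d : ℝ) (hd : 0 < d) : Summable fun k : ℕ => ‖((gaF d k : ℝ) : ℂ)‖ := by
  have h := Real.summable_pow_mul_exp_neg_nat_mul 1 hd
  refine Summable.of_nonneg_of_le (fun _ => norm_nonneg _) (fun k => ?_) h
  rw [Complex.norm_real, Real.norm_eq_abs, gaF, abs_of_nonneg (by positivity), pow_one]
  refine mul_le_mul_of_nonneg_left (Real.exp_le_exp.2 ?_) (Nat.cast_nonneg k)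
  have h1 : (k : ℝ) ≤ (k : ℝ) ^ 2 := by exact_mod_cast Nat.le_self_pow two_ne_zero k
  have := mul_le_mul_of_nonneg_left h1 hd.le
  linarith

lemma aux_glim (x : ℝ) : Tendsto (fun d => ((gaF d x : ℝ) : ℂ)) (nhdsWithin 0 (Set.Ioi 0))
    (nhds (x : ℂ)) := by
  have : Continuous fun d => ((gaF d x : ℝ) : ℂ) := by unfold gaF; fun_prop
  have h := (this.tendsto 0).mono_left (nhdsWithin_le_nhds (s := Set.Ioi 0))
  simpa [gaF] using h

lemma aux_eval (M : ℕ) (hM : 0 < M) (f F1 F2 : ℕ → ℂ) 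
    (h1p : ∀ k, F1 (k + M) = F1 k) (h1z : ∑ k ∈ range M, F1 (k + 1) = 0)
    (h1 : ∀ k, F1 (k + 1) - F1 k = f k)
    (h2p : ∀ k, F2 (k + M) = F2 k) (h2z : ∑ k ∈ range M, F2 (k + 1) = 0)
    (h2 : ∀ k, F2 (k + 1) - F2 k = F1 (k + 1)) :
    F2 0 = -(M / 2 : ℂ) * ∑ k ∈ range M, f k * (((k : ℂ) / M) ^ 2 - (k : ℂ) / M + 1 / 6) := by
  have hM' : (M : ℂ) ≠ 0 := by exact_mod_cast hM.ne'
  have key1 : ∀ L : ℕ, ∑ k ∈ range L, f k * (((k : ℂ) / M) ^ 2 - (k : ℂ) / M + 1 / 6)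
      = F1 L * (((L : ℂ) / M) ^ 2 - (L : ℂ) / M + 1 / 6) - F1 0 * (1 / 6)
        - (2 / M ^ 2 : ℂ) * ∑ k ∈ range L, k * F1 (k + 1)
        - (1 / M ^ 2 - 1 / M : ℂ) * ∑ k ∈ range L, F1 (k + 1) := by
    intro L
    induction L with
    | zero => simp
    | succ L ih =>
      rw [sum_range_succ, ih, sum_range_succ, sum_range_succ, ← h1 L]
      push_cast
      field_simp
      ring
  have key2 : ∀ L : ℕ, ∑ k ∈ range L, k * F1 (k + 1) = L * F2 L - ∑ k ∈ range L, F2 (k + 1) := by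
    intro L
    induction L with
    | zero => simp
    | succ L ih =>
      rw [sum_range_succ, ih, sum_range_succ, ← h2 L]
      push_cast
      ring
  have e1 := h1p 0
  have e2 := h2p 0
  rw [zero_add] at e1 e2
  rw [key1, key2, h1z, h2z, e1, e2]
  field_simp
  ring

lemma aux_main (M : ℕ) (hM : 0 < M) (f : ℕ → ℂ) (hp : ∀ k, f (k + M) = f k)
    (h0 : ∑ k ∈ range M, f k = 0) :
    Tendsto (fun d : ℝ => ∑' k : ℕ, f k * ((gaF d k : ℝ) : ℂ)) (nhdsWithin 0 (Set.Ioi 0))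
      (nhds (-(M / 2 : ℂ) *
        ∑ k ∈ range M, f k * (((k : ℂ) / M) ^ 2 - (k : ℂ) / M + 1 / 6))) := by
  obtain ⟨F1, p1, z1, d1⟩ := aux_antidiff M hM f hp h0
  have z1' := aux_shift M F1 p1 z1
  obtain ⟨F2, p2, z2, d2⟩ := aux_antidiff M hM (fun k => F1 (k + 1))
    (fun k => by rw [add_right_comm, p1]) z1'
  have z2' := aux_shift M F2 p2 z2
  obtain ⟨F3, p3, z3, d3⟩ := aux_antidiff M hM (fun k => F2 (k + 1))
    (fun k => by rw [add_right_comm, p2]) z2'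
  obtain ⟨C1, b1⟩ := aux_bdd M hM F1 p1
  obtain ⟨C2, b2⟩ := aux_bdd M hM F2 p2
  obtain ⟨C3, b3⟩ := aux_bdd M hM F3 p3
  rw [← aux_eval M hM f F1 F2 p1 z1' d1 p2 z2' d2]
  let a : ℝ → ℕ → ℂ := fun d k => ((gaF d k : ℝ) : ℂ)
  let a1 : ℝ → ℕ → ℂ := fun d k => a d k - a d (k + 1)
  let a2 : ℝ → ℕ → ℂ := fun d k => a1 d k - a1 d (k + 1)
  let a3 : ℝ → ℕ → ℂ := fun d k => a2 d k - a2 d (k + 1)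
  have la : ∀ k : ℕ, Tendsto (fun d => a d k) (nhdsWithin 0 (Set.Ioi 0)) (nhds (k : ℂ)) := by
    intro k
    simpa using aux_glim k
  have la1 : ∀ k : ℕ, Tendsto (fun d => a1 d k) (nhdsWithin 0 (Set.Ioi 0)) (nhds (-1 : ℂ)) := by
    intro k
    have := (la k).sub (la (k + 1))
    simpa using this
  have la2 : ∀ k : ℕ, Tendsto (fun d => a2 d k) (nhdsWithin 0 (Set.Ioi 0)) (nhds (0 : ℂ)) := by
    intro k
    have := (la1 k).sub (la1 (k + 1))
    simpa using this
  have la3 : ∀ k : ℕ, Tendsto (fun d => a3 d k) (nhdsWithin 0 (Set.Ioi 0)) (nhds (0 : ℂ)) := by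
    intro k
    have := (la2 k).sub (la2 (k + 1))
    simpa using this
  have hrest : Tendsto (fun d => ∑' k, F3 (k + 1) * a3 d k) (nhdsWithin 0 (Set.Ioi 0))
      (nhds (∑' _ : ℕ, (0 : ℂ))) := by
    have hb : Summable fun k : ℕ => C3 * (if k = 0 then 1 else 102 / (k : ℝ) ^ 2) := by
      refine Summable.mul_left _ ?_
      rw [← summable_nat_add_iff 1]
      have := (summable_nat_add_iff 1).2
        ((Real.summable_one_div_nat_pow.2 (one_lt_two)).mul_left 102)
      refine this.congr fun k => ?_
      simp
      ring
    have hC3 : 0 ≤ C3 := (norm_nonneg _).trans (b3 0)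
    refine tendsto_tsum_of_dominated_convergence hb (fun k => ?_) ?_
    · simpa using (la3 k).const_mul (F3 (k + 1))
    · have hz : ∀ᶠ d in nhdsWithin 0 (Set.Ioi 0), ‖a3 d 0‖ < 1 := by
        have := (la3 0).norm
        rw [norm_zero] at this
        exact this.eventually_lt_const one_pos
      filter_upwards [hz, self_mem_nhdsWithin] with d hd0 hd k
      rw [norm_mul]
      refine mul_le_mul (b3 _) ?_ (norm_nonneg _) hC3
      split_ifs with hk
      · rw [hk]; exact hd0.le
      · have hk' : (0 : ℝ) < k := by exact_mod_cast Nat.pos_of_ne_zero hk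
        have := aux_D3 d hd k hk'
        rw [← Real.norm_eq_abs, ← Complex.norm_real] at this
        simpa [a3, a2, a1, a] using this
  have heq : ∀ d : ℝ, 0 < d → ∑' k : ℕ, f k * ((gaF d k : ℝ) : ℂ)
      = -F1 0 * a d 0 + (-F2 0 * a1 d 0 + (-F3 0 * a2 d 0 + ∑' k, F3 (k + 1) * a3 d k)) := by
    intro d hd
    have s0 : Summable fun k => ‖a d k‖ := aux_gsumm d hd
    have s1 : Summable fun k => ‖a1 d k‖ := aux_dsumm _ s0
    have s2 : Summable fun k => ‖a2 d k‖ := aux_dsumm _ s1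
    rw [← aux_parts F3 (a2 d) C3 b3 s2]
    simp only [d3]
    rw [← aux_parts F2 (a1 d) C2 b2 s1]
    simp only [d2]
    rw [← aux_parts F1 (a d) C1 b1 s0]
    simp only [d1, a]
  have hl := ((la 0).const_mul (-F1 0)).add (((la1 0).const_mul (-F2 0)).add
    (((la2 0).const_mul (-F3 0)).add hrest))
  simp only [Nat.cast_zero, mul_zero, mul_neg, mul_one, neg_neg, tsum_zero, add_zero, zero_add] at hl
  refine hl.congr' ?_
  filter_upwards [self_mem_nhdsWithin] with d hd
  exact (heq d hd).symm

lemma aux_fact (s t : ℕ) (hst : s.Coprime t) (N : ℕ) (hN : N ≠ 0) :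
    ∃ A B : ℕ, A.Coprime B ∧ A * B = s * t * N ∧ s ∣ A ∧ t ∣ B := by
  induction N using induction_on_primes with
  | zero => exact absurd rfl hN
  | one => exact ⟨s, t, hst, by ring, dvd_rfl, dvd_rfl⟩
  | prime_mul p N hp ih =>
    obtain ⟨A, B, h1, h2, h3, h4⟩ := ih (by rintro rfl; simp at hN)
    by_cases hpB : p ∣ B
    · refine ⟨A, p * B, ?_, by rw [mul_left_comm, h2]; ring, h3, h4.mul_left p⟩
      refine Nat.Coprime.mul_right ?_ h1
      exact h1.coprime_dvd_right hpB
    · refine ⟨p * A, B, ?_, by rw [mul_assoc, h2]; ring, h3.mul_left p, h4⟩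
      exact Nat.Coprime.mul_left ((Nat.Prime.coprime_iff_not_dvd hp).2 hpB) h1

lemma aux_unit_odd (s t : ℤ) (hs : 0 < s) (ht : 0 < t) (hst : IsCoprime s t) (hodd : Odd t)
    (N : ℕ) (hN : 0 < N) :
    ∃ u : ℤ, 2 * s ∣ u - 1 ∧ 2 * t ∣ u + 1 ∧ 4 * s * t * N ∣ u ^ 2 - 1 := by
  lift s to ℕ using hs.le
  lift t to ℕ using ht.le
  have hst' : s.Coprime t := Nat.isCoprime_iff_coprime.1 hst
  have hodd' : Odd t := by exact_mod_cast hodd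
  have h2t : Nat.Coprime 2 t := Nat.coprime_two_left.2 hodd'
  obtain ⟨A, B, h1, h2, h3, h4⟩ := aux_fact (2 * s) t (h2t.mul_left hst') (2 * N) (by omega)
  obtain ⟨x, y, hxy⟩ := Nat.isCoprime_iff_coprime.2 h1
  have h3' : ((2 * s : ℕ) : ℤ) ∣ (A : ℤ) := by exact_mod_cast h3
  have h4' : (t : ℤ) ∣ (B : ℤ) := by exact_mod_cast h4
  refine ⟨1 - 2 * x * A, ?_, ?_, ?_⟩
  · push_cast at h3'
    have : (1 - 2 * x * A - 1 : ℤ) = A * (-2 * x) := by ring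
    rw [this]
    exact h3'.mul_right _
  · have : (1 - 2 * x * A + 1 : ℤ) = 2 * (B * y) := by linear_combination (-2) * hxy
    rw [this]
    exact mul_dvd_mul_left 2 (h4'.mul_right _)
  · have h2' : (A : ℤ) * B = 2 * s * t * (2 * N) := by exact_mod_cast h2
    refine ⟨-4 * x * y, ?_⟩
    linear_combination (-4 * x * y) * h2' + (4 * x * A) * hxy

lemma aux_unit (s t : ℤ) (hs : 0 < s) (ht : 0 < t) (hst : IsCoprime s t)
    (N : ℕ) (hN : 0 < N) :
    ∃ u : ℤ, 2 * s ∣ u - 1 ∧ 2 * t ∣ u + 1 ∧ 4 * s * t * N ∣ u ^ 2 - 1 := by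
  rcases Int.even_or_odd t with he | ho
  · have hso : Odd s := by
      rw [← Int.not_even_iff_odd]
      intro hse
      have := hst.isUnit_of_dvd' hse.two_dvd he.two_dvd
      norm_num [Int.isUnit_iff] at this
    obtain ⟨u, h1, h2, h3⟩ := aux_unit_odd t s ht hs hst.symm hso N hN
    refine ⟨-u, ?_, ?_, ?_⟩
    · have : -u - 1 = -(u + 1) := by ring
      rw [this]; exact h2.neg_right
    · have : -u + 1 = -(u - 1) := by ring
      rw [this]; exact h1.neg_right
    · rw [neg_sq]; convert h3 using 1; ring
  · exact aux_unit_odd s t hs ht hst ho N hN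

lemma aux_dj (s t n m : ℤ) (hs : 0 < s) (ht : 0 < t)
    (hn : 0 < n) (hns : n < s) (hm : 0 < m) (hmt : m < t) (k : ℤ)
    (h1 : k ≡ n * t - m * s [ZMOD 2 * s * t] ∨ k ≡ -(n * t - m * s) [ZMOD 2 * s * t])
    (h2 : k ≡ n * t + m * s [ZMOD 2 * s * t] ∨ k ≡ -(n * t + m * s) [ZMOD 2 * s * t]) : False := by
  have A : ¬ (2 * s * t ∣ 2 * s * m) := by
    intro h
    have := Int.le_of_dvd hm ((mul_dvd_mul_iff_left (by positivity)).1 h)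
    omega
  have B : ¬ (2 * s * t ∣ 2 * t * n) := by
    intro h
    rw [mul_right_comm] at h
    have := Int.le_of_dvd hn ((mul_dvd_mul_iff_left (by positivity)).1 h)
    omega
  rcases h1 with h1 | h1 <;> rcases h2 with h2 | h2
  · have := (h1.symm.trans h2).dvd
    apply A; convert this using 1; ring
  · have := (h1.symm.trans h2).symm.dvd
    apply B; convert this using 1; ring
  · have := (h1.symm.trans h2).dvd
    apply B; convert this using 1; ring
  · have := (h1.symm.trans h2).symm.dvd
    apply A; convert this using 1; ring

lemma aux_ite (P1 P2 Q1 Q2 : Prop) [Decidable P1] [Decidable P2] [Decidable Q1] [Decidable Q2]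
    (r1 : P1 → Q2) (r2 : P2 → Q1) (i1 : Q1 → P2) (i2 : Q2 → P1) (dk : Q1 → Q2 → False) :
    (if P1 then (1 : ℤ) else if P2 then -1 else 0) = -(if Q1 then 1 else if Q2 then -1 else 0) := by
  split_ifs <;> first | rfl | (exfalso; tauto)

lemma aux_chi (s t n m : ℤ) (hs : 0 < s) (ht : 0 < t)
    (hn : 0 < n) (hns : n < s) (hm : 0 < m) (hmt : m < t) (u : ℤ)
    (hu1 : 2 * s ∣ u - 1) (hu2 : 2 * t ∣ u + 1) (hu3 : 2 * s * t ∣ u ^ 2 - 1) (k : ℤ) :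
    chi s t n m (u * k) = - chi s t n m k := by
  have hP : u * (n * t - m * s) ≡ n * t + m * s [ZMOD 2 * s * t] := by
    obtain ⟨p, hp⟩ := hu1
    obtain ⟨q, hq⟩ := hu2
    refine (Int.modEq_iff_dvd.2 ⟨-n * p + m * q, ?_⟩)
    linear_combination (-n * t) * hp + (m * s) * hq
  have hQ : u * (n * t + m * s) ≡ n * t - m * s [ZMOD 2 * s * t] := by
    obtain ⟨p, hp⟩ := hu1
    obtain ⟨q, hq⟩ := hu2
    refine (Int.modEq_iff_dvd.2 ⟨-n * p - m * q, ?_⟩)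
    linear_combination (-n * t) * hp - (m * s) * hq
  have inv : ∀ j, u * (u * j) ≡ j [ZMOD 2 * s * t] := by
    intro j
    obtain ⟨p, hp⟩ := hu3
    refine (Int.modEq_iff_dvd.2 ⟨-p * j, ?_⟩)
    linear_combination (-j) * hp
  have imp1 : ∀ j, (j ≡ n * t - m * s [ZMOD 2 * s * t] ∨ j ≡ -(n * t - m * s) [ZMOD 2 * s * t]) →
      (u * j ≡ n * t + m * s [ZMOD 2 * s * t] ∨ u * j ≡ -(n * t + m * s) [ZMOD 2 * s * t]) := by
    rintro j (h | h)
    · exact Or.inl ((h.mul_left u).trans hP)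
    · right
      have := h.mul_left u
      rw [mul_neg] at this
      exact this.trans hP.neg
  have imp2 : ∀ j, (j ≡ n * t + m * s [ZMOD 2 * s * t] ∨ j ≡ -(n * t + m * s) [ZMOD 2 * s * t]) →
      (u * j ≡ n * t - m * s [ZMOD 2 * s * t] ∨ u * j ≡ -(n * t - m * s) [ZMOD 2 * s * t]) := by
    rintro j (h | h)
    · exact Or.inl ((h.mul_left u).trans hQ)
    · right
      have := h.mul_left u
      rw [mul_neg] at this
      exact this.trans hQ.neg
  have dk := aux_dj s t n m hs ht hn hns hm hmt k
  have r1 : (u * k ≡ n * t - m * s [ZMOD 2 * s * t] ∨ u * k ≡ -(n * t - m * s) [ZMOD 2 * s * t]) →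
      (k ≡ n * t + m * s [ZMOD 2 * s * t] ∨ k ≡ -(n * t + m * s) [ZMOD 2 * s * t]) := fun h =>
    (imp1 _ h).imp (fun h => (inv k).symm.trans h) (fun h => (inv k).symm.trans h)
  have r2 : (u * k ≡ n * t + m * s [ZMOD 2 * s * t] ∨ u * k ≡ -(n * t + m * s) [ZMOD 2 * s * t]) →
      (k ≡ n * t - m * s [ZMOD 2 * s * t] ∨ k ≡ -(n * t - m * s) [ZMOD 2 * s * t]) := fun h =>
    (imp2 _ h).imp (fun h => (inv k).symm.trans h) (fun h => (inv k).symm.trans h)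
  have i1 := imp1 k
  have i2 := imp2 k
  unfold chi
  exact aux_ite _ _ _ _ r1 r2 i1 i2 dk

lemma aux_chi_per (s t n m k j : ℤ) (h : k ≡ j [ZMOD 2 * s * t]) :
    chi s t n m k = chi s t n m j := by
  have : ∀ a, (k ≡ a [ZMOD 2 * s * t]) ↔ (j ≡ a [ZMOD 2 * s * t]) :=
    fun a => ⟨fun h' => h.symm.trans h', fun h' => h.trans h'⟩
  unfold chi
  simp only [this]

/-- The twisted periodic coefficient. -/
noncomputable def fF (s t n m : ℤ) (N : ℕ) (k : ℤ) : ℂ :=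
  (chi s t n m k : ℂ) * Complex.exp (Real.pi * Complex.I * (k : ℂ) ^ 2 / (2 * s * t * N))

lemma aux_e (s t : ℤ) (hs : 0 < s) (ht : 0 < t) (N : ℕ) (hN : 0 < N) (k j : ℤ)
    (h : 4 * s * t * N ∣ k ^ 2 - j ^ 2) :
    Complex.exp (Real.pi * Complex.I * (k : ℂ) ^ 2 / (2 * s * t * N)) =
      Complex.exp (Real.pi * Complex.I * (j : ℂ) ^ 2 / (2 * s * t * N)) := by
  obtain ⟨c, hc⟩ := h
  have hs' : (s : ℂ) ≠ 0 := by exact_mod_cast hs.ne'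
  have ht' : (t : ℂ) ≠ 0 := by exact_mod_cast ht.ne'
  have hN' : (N : ℂ) ≠ 0 := by exact_mod_cast hN.ne'
  rw [Complex.exp_eq_exp_iff_exists_int]
  refine ⟨c, ?_⟩
  have hc' : (k : ℂ) ^ 2 - (j : ℂ) ^ 2 = 4 * s * t * N * c := by exact_mod_cast hc
  field_simp
  linear_combination hc'

lemma aux_f_per (s t n m : ℤ) (hs : 0 < s) (ht : 0 < t) (N : ℕ) (hN : 0 < N) (k j : ℤ)
    (h : k ≡ j [ZMOD 2 * s * t * N]) : fF s t n m N k = fF s t n m N j := by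
  unfold fF
  rw [aux_chi_per s t n m k j (h.of_mul_right _), aux_e s t hs ht N hN k j]
  obtain ⟨c, hc⟩ := h.symm.dvd
  have : k = j + 2 * s * t * N * c := by linarith
  exact ⟨c * j + s * t * N * c ^ 2, by rw [this]; ring⟩

lemma aux_f_sum (s t n m : ℤ) (hs : 0 < s) (ht : 0 < t) (hst : IsCoprime s t)
    (hn : 0 < n) (hns : n < s) (hm : 0 < m) (hmt : m < t) (N : ℕ) (hN : 0 < N)
    (M : ℕ) (hM : (M : ℤ) = 2 * s * t * N) :
    ∑ k ∈ range M, fF s t n m N (k : ℤ) = 0 := by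
  obtain ⟨u, h1, h2, h3⟩ := aux_unit s t hs ht hst N hN
  have hM0 : (0 : ℤ) < M := by rw [hM]; positivity
  have hu : ∀ k, fF s t n m N (u * k) = - fF s t n m N k := by
    intro k
    unfold fF
    rw [aux_chi s t n m hs ht hn hns hm hmt u h1 h2
      (dvd_trans ⟨2 * N, by ring⟩ h3), aux_e s t hs ht N hN (u * k) k]
    · push_cast; ring
    · have : (u * k) ^ 2 - k ^ 2 = (u ^ 2 - 1) * k ^ 2 := by ring
      rw [this]; exact h3.mul_right _
  have hmem : ∀ k : ℕ, ((u * k % M).toNat : ℤ) = u * k % M := fun k =>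
    Int.toNat_of_nonneg (Int.emod_nonneg _ hM0.ne')
  have hlt : ∀ k : ℕ, (u * k % M).toNat < M := fun k => by
    have := Int.emod_lt_of_pos (u * k) hM0
    have := hmem k
    omega
  have hinv : ∀ k ∈ range M, (u * ((u * k % M).toNat : ℤ) % M).toNat = k := by
    intro k hk
    have hk' : (k : ℤ) < M := by exact_mod_cast Finset.mem_range.1 hk
    zify
    rw [hmem, hmem]
    have : u * (u * (k : ℤ) % M) ≡ k [ZMOD M] := by
      refine ((Int.mod_modEq _ _).mul_left u).trans ?_
      obtain ⟨c, hc⟩ := h3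
      refine Int.modEq_iff_dvd.2 ⟨-2 * c * k, ?_⟩
      rw [hM]
      linear_combination (-(k : ℤ)) * hc
    rw [this.eq, Int.emod_eq_of_lt (by positivity) hk']
  have key : ∑ k ∈ range M, fF s t n m N (k : ℤ) = ∑ k ∈ range M, fF s t n m N (u * k) := by
    symm
    refine Finset.sum_nbij' (fun k => (u * (k : ℤ) % M).toNat) (fun k => (u * (k : ℤ) % M).toNat)
      (fun k _ => Finset.mem_range.2 (hlt k)) (fun k _ => Finset.mem_range.2 (hlt k)) hinv hinv ?_
    intro k _
    apply aux_f_per s t n m hs ht N hN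
    rw [hmem, ← hM]
    exact (Int.mod_modEq _ _).symm
  simp only [hu, Finset.sum_neg_distrib] at key
  exact self_eq_neg.1 key

lemma aux_Icc (M : ℕ) (G : ℤ → ℂ) (h : G M = G 0) :
    ∑ k ∈ Finset.Icc (1 : ℤ) M, G k = ∑ k ∈ range M, G (k : ℤ) := by
  have h1 : ∑ k ∈ Finset.Icc (1 : ℤ) M, G k = ∑ k ∈ range M, G ((k : ℤ) + 1) := by
    refine Finset.sum_nbij' (fun k => (k - 1).toNat) (fun k => (k : ℤ) + 1) ?_ ?_ ?_ ?_ ?_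
    · intro k hk
      rw [Finset.mem_Icc] at hk
      rw [Finset.mem_range]
      omega
    · intro k hk
      rw [Finset.mem_range] at hk
      rw [Finset.mem_Icc]
      omega
    · intro k hk
      rw [Finset.mem_Icc] at hk
      omega
    · intro k hk
      omega
    · intro k hk
      rw [Finset.mem_Icc] at hk
      congr 1
      omega
  rw [h1]
  have h2 := Finset.sum_range_succ (fun k : ℕ => G (k : ℤ)) M
  rw [Finset.sum_range_succ'] at h2
  push_cast at h2
  rw [h] at h2
  exact add_right_cancel h2

theorem statement12 (s t n m : ℤ) (hs : 0 < s) (ht : 0 < t) (hst : IsCoprime s t)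
    (hn : 0 < n) (hns : n < s) (hm : 0 < m) (hmt : m < t) (N : ℕ) (hN : 0 < N) :
    Tendsto (fun ε : ℝ =>
        -(1 / 2 : ℂ) * ∑' k : ℕ, (k : ℂ) * (chi s t n m k : ℂ) *
          Complex.exp (2 * Real.pi * Complex.I * ((1 / N : ℂ) + Complex.I * ε) *
            (k : ℂ) ^ 2 / (4 * s * t)))
      (nhdsWithin 0 (Set.Ioi 0))
      (nhds (((s * t * N : ℤ) : ℂ) / 2 *
        ∑ k ∈ Finset.Icc (1 : ℤ) (2 * s * t * N),
          (chi s t n m k : ℂ) *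
            Complex.exp (Real.pi * Complex.I * (k : ℂ) ^ 2 / (2 * s * t * N)) *
            (((k : ℂ) / (2 * s * t * N)) ^ 2 - (k : ℂ) / (2 * s * t * N) + 1 / 6))) := by
  obtain ⟨M, hM⟩ : ∃ M : ℕ, (M : ℤ) = 2 * s * t * N :=
    ⟨(2 * s * t * N).toNat, Int.toNat_of_nonneg (by positivity)⟩
  have hM0 : 0 < M := by
    have : (0 : ℤ) < M := by rw [hM]; positivity
    exact_mod_cast this
  have hMC : (M : ℂ) = 2 * s * t * N := by exact_mod_cast hM
  have hs' : (s : ℂ) ≠ 0 := by exact_mod_cast hs.ne'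
  have ht' : (t : ℂ) ≠ 0 := by exact_mod_cast ht.ne'
  have hN' : (N : ℂ) ≠ 0 := by exact_mod_cast hN.ne'
  have hsR : (0 : ℝ) < s := by exact_mod_cast hs
  have htR : (0 : ℝ) < t := by exact_mod_cast ht
  have hmain := aux_main M hM0 (fun k => fF s t n m N (k : ℤ))
    (fun k => by
      apply aux_f_per s t n m hs ht N hN
      rw [← hM]
      push_cast
      simp [Int.ModEq])
    (aux_f_sum s t n m hs ht hst hn hns hm hmt N hN M hM)
  have hdelta : Tendsto (fun ε : ℝ => Real.pi / (2 * s * t) * ε) (nhdsWithin 0 (Set.Ioi 0))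
      (nhdsWithin 0 (Set.Ioi 0)) := by
    refine tendsto_nhdsWithin_iff.2 ⟨?_, ?_⟩
    · have : Continuous fun ε : ℝ => Real.pi / (2 * s * t) * ε := by fun_prop
      have h := (this.tendsto 0).mono_left (nhdsWithin_le_nhds (s := Set.Ioi 0))
      simpa using h
    · filter_upwards [self_mem_nhdsWithin] with ε hε
      have : (0 : ℝ) < ε := hε
      have := Real.pi_pos
      exact Set.mem_Ioi.2 (by positivity)
  have hlim := (hmain.comp hdelta).const_mul (-(1 / 2 : ℂ))
  have hval : ((s * t * N : ℤ) : ℂ) / 2 *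
        ∑ k ∈ Finset.Icc (1 : ℤ) (2 * s * t * N),
          (chi s t n m k : ℂ) *
            Complex.exp (Real.pi * Complex.I * (k : ℂ) ^ 2 / (2 * s * t * N)) *
            (((k : ℂ) / (2 * s * t * N)) ^ 2 - (k : ℂ) / (2 * s * t * N) + 1 / 6)
      = -(1 / 2 : ℂ) * (-(M / 2 : ℂ) * ∑ k ∈ range M, fF s t n m N (k : ℤ) *
          (((k : ℂ) / M) ^ 2 - (k : ℂ) / M + 1 / 6)) := by
    have hI := aux_Icc M (fun k => fF s t n m N k *
          (((k : ℂ) / M) ^ 2 - (k : ℂ) / M + 1 / 6)) (by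
      have hMne : (M : ℂ) ≠ 0 := by exact_mod_cast hM0.ne'
      rw [aux_f_per s t n m hs ht N hN (M : ℤ) 0 (by rw [← hM]; simp [Int.ModEq])]
      simp [hMne])
    simp only [Int.cast_natCast] at hI
    rw [← hI, hM, hMC]
    simp only [fF]
    push_cast
    ring
  rw [hval]
  refine hlim.congr fun ε => ?_
  simp only [Function.comp]
  congr 1
  refine tsum_congr fun k => ?_
  simp only [fF, gaF]
  push_cast
  have : 2 * (Real.pi : ℂ) * Complex.I * ((1 / N : ℂ) + Complex.I * ε) * (k : ℂ) ^ 2 / (4 * s * t)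
      = Real.pi * Complex.I * (k : ℂ) ^ 2 / (2 * s * t * N)
        + (-(Real.pi / (2 * s * t) * ε) * (k : ℂ) ^ 2) := by
    field_simp
    linear_combination (4 * (ε : ℂ) * N * (k : ℂ) ^ 2) * Complex.I_sq
  rw [this, Complex.exp_add]
  ring
end

section
/- Let p and a be integers with 0 < a < p. For every nonnegative integer K there is a constant C such that for all positive integers N, | Ψ̃_p^{(a)}(1/N) + √(N/i) · Σ_{b=1}^{p−1} √(2/p) · sin(abπ/p) · (1 − b/p) · exp( −πib²N/(2p) ) − Σ_{k=0}^{K} ( L(−2k, ψ_{2p}^{(a)})/k! ) · ( πi/(2pN) )^k | ≤ C·N^{−K−1}, where Ψ̃_p^{(a)}(1/N) := −Σ_{k=1}^{2pN} ψ_{2p}^{(a)}(k) · exp( πik²/(2pN) ) · B₁( k/(2pN) ) and L(−j, ψ_{2p}^{(a)}) := −( (2p)^j/(j+1) ) · Σ_{l=1}^{2p} ψ_{2p}^{(a)}(l) · B_{j+1}( l/(2p) ). (This is the quantum modularity / asymptotic expansion of the Eichler integral Ψ̃ at τ = 1/N.) -/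
open Complex Finset

/-- The 2p-periodic function `ψ_{2p}^{(a)}`. -/
def psi (p a k : ℤ) : ℤ :=
  if k ≡ a [ZMOD 2 * p] then 1 else if k ≡ -a [ZMOD 2 * p] then -1 else 0

/-- The limiting value `Ψ̃_p^{(a)}(1/N)` of the Eichler integral. -/
noncomputable def PsiTilde (p a : ℤ) (N : ℕ) : ℂ :=
  -∑ k ∈ Finset.Icc (1 : ℤ) (2 * p * N),
      (psi p a k : ℂ) * Complex.exp (Real.pi * Complex.I * (k : ℂ) ^ 2 / (2 * p * N)) *
        ((k : ℂ) / (2 * p * N) - 1 / 2)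

/-- The L-value `L(-j, ψ_{2p}^{(a)}) = -((2p)^j/(j+1)) Σ_{l=1}^{2p} ψ_{2p}^{(a)}(l) B_{j+1}(l/(2p))`. -/
noncomputable def Lval (p a : ℤ) (j : ℕ) : ℂ :=
  -(((2 * p : ℤ) : ℂ) ^ j / ((j : ℂ) + 1)) *
    ∑ l ∈ Finset.Icc (1 : ℤ) (2 * p),
      (psi p a l : ℂ) * (((Polynomial.bernoulli (j + 1)).eval ((l : ℚ) / (2 * p)) : ℚ) : ℂ)


/-- boundary integral over a rectangle -/
noncomputable def rectI (f : ℂ → ℂ) (x0 x1 y0 y1 : ℝ) : ℂ :=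
  (∫ x : ℝ in x0..x1, f (x + y0 * I)) - (∫ x : ℝ in x0..x1, f (x + y1 * I)) +
    I * (∫ y : ℝ in y0..y1, f (x1 + y * I)) - I * (∫ y : ℝ in y0..y1, f (x0 + y * I))

lemma log_I_mul_of (u : ℂ) (h1 : 0 < u.re) (h2 : u.im < 0) :
    Complex.log (I * u) = Complex.log u + Real.pi / 2 * I := by
  have hu : u ≠ 0 := by rintro rfl; simp at h1
  rw [(Complex.log_mul_eq_add_log_iff I_ne_zero hu).2, Complex.log_I]
  · ring
  · rw [Complex.arg_I]
    have := Complex.abs_arg_lt_pi_div_two_iff.2 (Or.inl h1)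
    rw [abs_lt] at this
    constructor <;> linarith [Real.pi_pos, this.1, this.2]

lemma side_int (w z0 d c : ℂ) (hc : c ≠ 0) (t0 t1 : ℝ)
    (h : ∀ t : ℝ, 0 < (c * (z0 + t * d - w)).re) :
    ∫ t in t0..t1, d * (z0 + t * d - w)⁻¹ =
      Complex.log (c * (z0 + t1 * d - w)) - Complex.log (c * (z0 + t0 * d - w)) := by
  have hne : ∀ t : ℝ, z0 + t * d - w ≠ 0 := by
    intro t h0
    have := h t
    rw [h0] at this; simp at this
  apply intervalIntegral.integral_eq_sub_of_hasDerivAt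
  · intro t _
    have h1 : HasDerivAt (fun t : ℝ => c * (z0 + (t : ℂ) * d - w)) (c * (1 * d)) t := by
      exact (((((hasDerivAt_id t).ofReal_comp).mul_const d).const_add z0).sub_const w).const_mul c
    have h2 := h1.clog_real (Or.inl (h t))
    rw [mul_div_mul_left _ _ hc, one_mul, div_eq_mul_inv] at h2
    exact h2
  · apply Continuous.intervalIntegrable
    apply Continuous.mul continuous_const
    apply Continuous.inv₀ (by fun_prop) hne

lemma rectI_inv (x0 x1 y0 y1 : ℝ) (w : ℂ) (h1 : x0 < w.re) (h2 : w.re < x1) (h3 : y0 < w.im)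
    (h4 : w.im < y1) : rectI (fun z => (z - w)⁻¹) x0 x1 y0 y1 = 2 * Real.pi * I := by
  have e1 := side_int w (y0 * I) 1 I I_ne_zero x0 x1 (by intro t; simp; linarith)
  have e2 := side_int w (x1) I 1 one_ne_zero y0 y1 (by intro t; simp; linarith)
  have e3 := side_int w (y1 * I) 1 (-I) (by simp) x0 x1 (by intro t; simp; linarith)
  have e4 := side_int w (x0) I (-1) (by simp) y0 y1 (by intro t; simp; linarith)
  have c1 := log_I_mul_of (x1 + y0 * I - w) (by simp; linarith) (by simp; linarith)
  have c2 := log_I_mul_of (-I * (x1 + y1 * I - w)) (by simp; linarith) (by simp; linarith)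
  have c3 := log_I_mul_of (-1 * (x0 + y1 * I - w)) (by simp; linarith) (by simp; linarith)
  have c4 := log_I_mul_of (I * (x0 + y0 * I - w)) (by simp; linarith) (by simp; linarith)
  have s2 : I * (-I * (x1 + y1 * I - w)) = 1 * (x1 + y1 * I - w) := by
    rw [← mul_assoc]; simp
  have s3 : I * (-1 * (x0 + y1 * I - w)) = -I * (x0 + y1 * I - w) := by ring
  have s4 : I * (I * (x0 + y0 * I - w)) = -1 * (x0 + y0 * I - w) := by
    rw [← mul_assoc]; simp
  rw [s2] at c2
  rw [s3] at c3
  rw [s4] at c4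
  unfold rectI
  rw [intervalIntegral.integral_const_mul] at e2 e4
  simp only [one_mul, mul_one] at e1 e2 e3 e4 c1 c2 c3 c4
  have t : ∀ (x y : ℝ), (y : ℂ) * I + x - w = x + y * I - w := by intros; ring
  simp only [t] at e1 e3
  rw [e1, e2, e3, e4, c1, c2, c3, c4]
  ring

lemma rectI_cauchy (f : ℂ → ℂ) (x0 x1 y0 y1 : ℝ) (w : ℂ) (h1 : x0 < w.re) (h2 : w.re < x1)
    (h3 : y0 < w.im) (h4 : w.im < y1)
    (hf : DifferentiableOn ℂ f (Set.uIcc x0 x1 ×ℂ Set.uIcc y0 y1)) :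
    rectI (fun z => f z / (z - w)) x0 x1 y0 y1 = 2 * Real.pi * I * f w := by
  have hx : x0 ≤ x1 := by linarith
  have hy : y0 ≤ y1 := by linarith
  have hn : (Set.uIcc x0 x1 ×ℂ Set.uIcc y0 y1) ∈ nhds w := by
    rw [Set.uIcc_of_le hx, Set.uIcc_of_le hy]
    apply Filter.mem_of_superset (x := Set.Ioo x0 x1 ×ℂ Set.Ioo y0 y1)
    · exact (isOpen_Ioo.reProdIm isOpen_Ioo).mem_nhds ⟨⟨h1, h2⟩, ⟨h3, h4⟩⟩
    · exact fun z hz => ⟨⟨hz.1.1.le, hz.1.2.le⟩, ⟨hz.2.1.le, hz.2.2.le⟩⟩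
  have hd := (Complex.differentiableOn_dslope hn).2 hf
  have key := Complex.integral_boundary_rect_eq_zero_of_differentiableOn (dslope f w)
    ⟨x0, y0⟩ ⟨x1, y1⟩ hd
  have hinv := rectI_inv x0 x1 y0 y1 w h1 h2 h3 h4
  have hds : ∀ z, z ≠ w → f z / (z - w) = dslope f w z + f w * (z - w)⁻¹ := by
    intro z hz
    have := sub_smul_dslope f w z
    have hz' : z - w ≠ 0 := sub_ne_zero.2 hz
    rw [smul_eq_mul] at this
    field_simp
    linear_combination -this
  have ne1 : ∀ x y : ℝ, y ≠ w.im → (x + y * I : ℂ) ≠ w := by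
    intro x y h e; apply h; rw [← e]; simp
  have ne2 : ∀ x y : ℝ, x ≠ w.re → (x + y * I : ℂ) ≠ w := by
    intro x y h e; apply h; rw [← e]; simp
  have hdc := hd.continuousOn
  have H1 : ∀ y : ℝ, y ≠ w.im → y ∈ Set.uIcc y0 y1 →
      ∫ x : ℝ in x0..x1, f (x + y * I) / (x + y * I - w) =
        (∫ x : ℝ in x0..x1, dslope f w (x + y * I)) + f w * ∫ x : ℝ in x0..x1, (x + y * I - w)⁻¹ := by
    intro y hy hy'
    rw [← intervalIntegral.integral_const_mul, ← intervalIntegral.integral_add]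
    · congr 1; ext x; exact hds _ (ne1 _ _ hy)
    · apply ContinuousOn.intervalIntegrable
      apply hdc.comp (by fun_prop)
      intro x hx; exact ⟨by simpa using hx, by simpa using hy'⟩
    · apply Continuous.intervalIntegrable
      apply Continuous.mul continuous_const
      apply Continuous.inv₀ (by fun_prop) (fun x => sub_ne_zero.2 (ne1 _ _ hy))
  have H2 : ∀ x : ℝ, x ≠ w.re → x ∈ Set.uIcc x0 x1 →
      ∫ y : ℝ in y0..y1, f (x + y * I) / (x + y * I - w) =
        (∫ y : ℝ in y0..y1, dslope f w (x + y * I)) + f w * ∫ y : ℝ in y0..y1, (x + y * I - w)⁻¹ := by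
    intro x hx hx'
    rw [← intervalIntegral.integral_const_mul, ← intervalIntegral.integral_add]
    · congr 1; ext y; exact hds _ (ne2 _ _ hx)
    · apply ContinuousOn.intervalIntegrable
      apply hdc.comp (by fun_prop)
      intro y hy; exact ⟨by simpa using hx', by simpa using hy⟩
    · apply Continuous.intervalIntegrable
      apply Continuous.mul continuous_const
      apply Continuous.inv₀ (by fun_prop) (fun y => sub_ne_zero.2 (ne2 _ _ hx))
  unfold rectI at hinv ⊢
  rw [H1 y0 h3.ne Set.left_mem_uIcc, H1 y1 h4.ne' Set.right_mem_uIcc,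
    H2 x0 h1.ne Set.left_mem_uIcc, H2 x1 h2.ne' Set.right_mem_uIcc]
  simp only [smul_eq_mul] at key
  linear_combination key + f w * hinv

/-- `exp (-iπ/4)` -/
noncomputable def W : ℂ := ((√2 / 2 : ℝ) : ℂ) * (1 - I)

lemma W_re (z : ℂ) : (W * z).re = √2 / 2 * (z.re + z.im) := by
  simp [W]; ring

lemma W_im (z : ℂ) : (W * z).im = √2 / 2 * (z.im - z.re) := by
  simp [W]; ring

lemma W_ne : W ≠ 0 := by
  intro h
  have := W_re 1
  rw [h] at this
  have h2 : 0 < √2 := by positivity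
  simp at this
  linarith

lemma W_sq : W ^ 2 = -I := by
  have h : ((√2 : ℝ) : ℂ) ^ 2 = 2 := by
    rw [← Complex.ofReal_pow, Real.sq_sqrt (by norm_num)]; simp
  unfold W
  push_cast
  linear_combination ((1 - I) ^ 2 / 4) * h + (1 / 2 : ℂ) * I_sq

lemma norm_W : ‖W‖ = 1 := by
  have h : ‖W‖ ^ 2 = 1 := by rw [← norm_pow, W_sq]; simp
  have := norm_nonneg W
  nlinarith

/-- `1/(exp (π x/p) - 1)` -/
noncomputable def ph (p : ℝ) (x : ℂ) : ℂ := 1 / (Complex.exp (Real.pi * x / p) - 1)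

lemma ph_pole (p : ℝ) (hp : 0 < p) (c : ℝ) (hc : 0 < c) (hc2 : c < 2 * p) (z : ℂ)
    (hz0 : 0 ≤ z.im) (hz1 : z.im ≤ √2 * p)
    (h : Complex.exp (Real.pi * (W * z - c * I) / p) = 1) :
    z.re = -(c * (√2 / 2)) ∧ z.im = c * (√2 / 2) := by
  have hpi : (Real.pi : ℂ) ≠ 0 := by exact_mod_cast Real.pi_ne_zero
  have hpc : (p : ℂ) ≠ 0 := by exact_mod_cast hp.ne'
  have h2 : √2 ^ 2 = 2 := Real.sq_sqrt (by norm_num)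
  have h2p : 0 < √2 := by positivity
  rw [Complex.exp_eq_one_iff] at h
  obtain ⟨n, hn⟩ := h
  have e : W * z = ((c + 2 * p * n : ℝ) : ℂ) * I := by
    have : W * z = c * I + p / Real.pi * (Real.pi * (W * z - c * I) / p) := by field_simp; ring
    rw [this, hn]; push_cast; field_simp
  have er := congrArg Complex.re e
  have ei := congrArg Complex.im e
  rw [W_re] at er
  rw [W_im] at ei
  simp at er ei
  have hzr : z.re = - z.im := by
    linarith
  rw [hzr] at ei
  have hz3 : √2 * z.im = c + 2 * p * n := by linarith
  have hz4 : 0 ≤ c + 2 * p * n := by rw [← hz3]; positivity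
  have hz5 : c + 2 * p * n ≤ 2 * p := by
    rw [← hz3]; nlinarith
  have n0 : n = 0 := by
    have a1 : -1 < n := by
      by_contra hh
      have : (n : ℝ) ≤ -1 := by exact_mod_cast not_lt.1 hh
      nlinarith
    have a2 : n < 1 := by
      by_contra hh
      have : (1 : ℝ) ≤ n := by exact_mod_cast not_lt.1 hh
      nlinarith
    omega
  rw [n0] at hz3
  simp at hz3
  have : z.im = c * (√2 / 2) := by
    rw [← hz3]; linear_combination (-z.im / 2) * h2
  exact ⟨by rw [hzr, this], this⟩

lemma rectI_ph (p : ℝ) (hp : 0 < p) (c : ℝ) (hc : 0 < c) (hc2 : c < 2 * p) (E : ℂ → ℂ)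
    (hE : Differentiable ℂ E) (R : ℝ) (hR : 2 * p < R) :
    rectI (fun z => E (W * z) * ph p (W * z - c * I)) (-R) R 0 (√2 * p) =
      2 * Real.pi * I * (E (c * I) * (p / (Real.pi * W))) := by
  have hpi : (Real.pi : ℂ) ≠ 0 := by exact_mod_cast Real.pi_ne_zero
  have hpc : (p : ℂ) ≠ 0 := by exact_mod_cast hp.ne'
  have hW := W_ne
  have h2 : √2 ^ 2 = 2 := Real.sq_sqrt (by norm_num)
  have h2p : 0 < √2 := by positivity
  have h2l : √2 < 2 := by nlinarith
  set w : ℂ := ((c * (√2 / 2) : ℝ) : ℂ) * (-1 + I) with hw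
  have wre : w.re = - (c * (√2 / 2)) := by simp [hw]
  have wim : w.im = c * (√2 / 2) := by simp [hw]
  have hWw : W * w = c * I := by
    apply Complex.ext
    · rw [W_re, wre, wim]; simp
    · rw [W_im, wre, wim]; simp; linear_combination (c / 2) * h2
  set e1 : ℂ → ℂ := dslope Complex.exp 0 with he1
  have e1d : Differentiable ℂ e1 := by
    rw [← differentiableOn_univ]
    exact (Complex.differentiableOn_dslope Filter.univ_mem).2 Complex.differentiable_exp.differentiableOn
  have e1v : ∀ v, v * e1 v = Complex.exp v - 1 := by
    intro v
    have := sub_smul_dslope Complex.exp 0 v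
    simpa using this
  have e10 : e1 0 = 1 := by
    rw [he1, dslope_same]; simp
  set f : ℂ → ℂ := fun z => E (W * z) * (p / (Real.pi * W)) / e1 (Real.pi * W / p * (z - w)) with hf
  have hfeq : (fun z => E (W * z) * ph p (W * z - c * I)) = fun z => f z / (z - w) := by
    ext z
    have hv := e1v (Real.pi * W / p * (z - w))
    have : Real.pi * (W * z - c * I) / p = Real.pi * W / p * (z - w) := by
      rw [← hWw]; ring
    simp only [ph, hf]
    rw [this, ← hv]
    simp only [div_eq_mul_inv, mul_inv, inv_inv]
    ring
  rw [hfeq, rectI_cauchy f (-R) R 0 (√2 * p) w]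
  · simp only [hf, sub_self, mul_zero, e10, hWw, div_one]
  · rw [wre]; nlinarith
  · rw [wre]; nlinarith
  · rw [wim]; positivity
  · rw [wim]; nlinarith
  · intro z hz
    apply DifferentiableAt.differentiableWithinAt
    apply DifferentiableAt.div
    · fun_prop
    · fun_prop
    · intro h0
      have hv := e1v (Real.pi * W / p * (z - w))
      rw [h0, mul_zero, eq_comm, sub_eq_zero] at hv
      have hz2 := hz.2
      rw [Set.uIcc_of_le (by positivity)] at hz2
      have : Real.pi * (W * z - c * I) / p = Real.pi * W / p * (z - w) := by
        rw [← hWw]; ring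
      rw [← this] at hv
      obtain ⟨k1, k2⟩ := ph_pole p hp c hc hc2 z hz2.1 hz2.2 hv
      have hzw : z = w := Complex.ext (by rw [k1, wre]) (by rw [k2, wim])
      rw [hzw] at h0
      simp [e10] at h0

/-- the kernel -/
noncomputable def hh (p a : ℝ) (x : ℂ) : ℂ := ph p (x - a * I) - ph p (x - (2 * p - a : ℝ) * I)

lemma ph_fst (p a : ℝ) (x : ℂ) : ph p (x - a * I) =
    1 / (Complex.exp (Real.pi * x / p) * (Complex.exp (Real.pi * a / p * I))⁻¹ - 1) := by
  rw [ph, ← Complex.exp_neg, ← Complex.exp_add]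
  congr 3; ring

lemma ph_snd (p a : ℝ) (hp : 0 < p) (x : ℂ) : ph p (x - (2 * p - a : ℝ) * I) =
    1 / (Complex.exp (Real.pi * x / p) * (Complex.exp (Real.pi * a / p * I)) - 1) := by
  have hpc : (p : ℂ) ≠ 0 := by exact_mod_cast hp.ne'
  rw [ph, ← Complex.exp_add]
  have : (Real.pi * (x - (2 * p - a : ℝ) * I) / p : ℂ) =
    Real.pi * x / p + Real.pi * a / p * I - 2 * Real.pi * I := by push_cast; field_simp; ring
  rw [this, Complex.exp_sub, Complex.exp_two_pi_mul_I, div_one]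

lemma ph_periodic (p : ℝ) (hp : 0 < p) (x : ℂ) : ph p (x + 2 * p * I) = ph p x := by
  have hpc : (p : ℂ) ≠ 0 := by exact_mod_cast hp.ne'
  rw [ph, ph]
  have : (Real.pi * (x + 2 * p * I) / p : ℂ) = Real.pi * x / p + 2 * Real.pi * I := by
    field_simp
  rw [this, Complex.exp_add, Complex.exp_two_pi_mul_I, mul_one]

lemma hh_periodic (p a : ℝ) (hp : 0 < p) (x : ℂ) : hh p a (x + 2 * p * I) = hh p a x := by
  rw [hh, hh, ← ph_periodic p hp (x - a * I), ← ph_periodic p hp (x - (2 * p - a : ℝ) * I)]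
  congr 2 <;> ring

lemma hh_bound (p a : ℝ) (hp : 0 < p) (x : ℂ) (h : 1 ≤ |Real.pi * x.re / p|) :
    ‖hh p a x‖ ≤ 8 * Real.exp (-|Real.pi * x.re / p|) := by
  rw [hh, ph_fst, ph_snd p a hp]
  set y := Complex.exp (Real.pi * x / p) with hy
  set ζ := Complex.exp (Real.pi * a / p * I) with hζ
  have nζ : ‖ζ‖ = 1 := by
    rw [hζ]
    have : (Real.pi * a / p * I : ℂ) = ((Real.pi * a / p : ℝ) : ℂ) * I := by push_cast; ring
    rw [this, Complex.norm_exp_ofReal_mul_I]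
  set u := Real.pi * x.re / p with hu
  have ny : ‖y‖ = Real.exp u := by
    rw [hy, Complex.norm_exp]
    congr 1
    have : (Real.pi * x / p : ℂ) = ((Real.pi / p : ℝ) : ℂ) * x := by push_cast; ring
    rw [this, Complex.re_ofReal_mul, hu]; ring
  set t := Real.exp u with ht
  have tpos : 0 < t := Real.exp_pos _
  have hA : |t - 1| ≤ ‖y * ζ⁻¹ - 1‖ := by
    have := abs_norm_sub_norm_le (y * ζ⁻¹) 1
    simpa [nζ, ny] using this
  have hB : |t - 1| ≤ ‖y * ζ - 1‖ := by
    have := abs_norm_sub_norm_le (y * ζ) 1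
    simpa [nζ, ny] using this
  have hnum : ‖(y * ζ - 1) - (y * ζ⁻¹ - 1)‖ ≤ 2 * t := by
    calc _ = ‖y * ζ - y * ζ⁻¹‖ := by congr 1; ring
      _ ≤ ‖y * ζ‖ + ‖y * ζ⁻¹‖ := norm_sub_le _ _
      _ = 2 * t := by simp [nζ, ny]; ring
  have key : ∀ m : ℝ, 0 < m → m ≤ |t - 1| →
      ‖1 / (y * ζ⁻¹ - 1) - 1 / (y * ζ - 1)‖ ≤ 2 * t / m ^ 2 := by
    intro m hm hm2
    have a1 : 0 < ‖y * ζ⁻¹ - 1‖ := by linarith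
    have a2 : 0 < ‖y * ζ - 1‖ := by linarith
    rw [div_sub_div _ _ (norm_pos_iff.1 a1) (norm_pos_iff.1 a2), one_mul, mul_one, norm_div, norm_mul]
    gcongr
    rw [sq]
    gcongr <;> linarith
  rcases le_abs.1 h with h1 | h1
  · have t2 : 2 ≤ t := by
      have := Real.add_one_le_exp u
      linarith
    rw [abs_of_nonneg (by linarith), Real.exp_neg, ← ht]
    refine (key (t / 2) (by positivity) (by rw [abs_of_nonneg] <;> linarith)).trans (le_of_eq ?_)
    field_simp; norm_num
  · have t2 : t ≤ 1 / 2 := by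
      have := Real.add_one_le_exp (-u)
      rw [Real.exp_neg, ← ht] at this
      have : 2 ≤ t⁻¹ := by linarith
      rw [le_inv_comm₀ (by norm_num) tpos] at this
      linarith
    rw [abs_of_nonpos (by linarith), neg_neg, ← ht]
    refine (key (1 / 2) (by positivity) (by rw [abs_of_nonpos] <;> linarith)).trans (le_of_eq ?_)
    ring

lemma ph_ne (p : ℝ) (hp : 0 < p) (c : ℝ) (hc : 0 < c) (hc2 : c < 2 * p) (z : ℂ)
    (hz0 : 0 ≤ z.im) (hz1 : z.im ≤ √2 * p) (hz : z.im = 0 ∨ z.im = √2 * p ∨ 2 * p < |z.re|) :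
    Complex.exp (Real.pi * (W * z - c * I) / p) - 1 ≠ 0 := by
  intro h
  obtain ⟨h1, h2⟩ := ph_pole p hp c hc hc2 z hz0 hz1 (sub_eq_zero.1 h)
  have h2 : √2 ^ 2 = 2 := Real.sq_sqrt (by norm_num)
  have h2p : 0 < √2 := by positivity
  have h2l : √2 < 2 := by nlinarith
  rcases hz with h | h | h
  · nlinarith
  · nlinarith
  · rw [h1, abs_neg, abs_of_pos (by positivity)] at h
    nlinarith

lemma ph_cont (p : ℝ) (hp : 0 < p) (c : ℝ) (hc : 0 < c) (hc2 : c < 2 * p) (z : ℂ)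
    (hz0 : 0 ≤ z.im) (hz1 : z.im ≤ √2 * p) (hz : z.im = 0 ∨ z.im = √2 * p ∨ 2 * p < |z.re|) :
    ContinuousAt (fun z => ph p (W * z - c * I)) z := by
  unfold ph
  apply ContinuousAt.div continuousAt_const (by fun_prop)
  exact ph_ne p hp c hc hc2 z hz0 hz1 hz

lemma hh_cont_line (p a : ℝ) (hp : 0 < p) (ha : 0 < a) (ha2 : a < 2 * p) :
    Continuous fun s : ℝ => hh p a (W * s) := by
  rw [continuous_iff_continuousAt]
  intro s
  have h1 := ph_cont p hp a ha ha2 s (by simp) (by simp; positivity) (by simp)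
  have h2 := ph_cont p hp (2 * p - a) (by linarith) (by linarith) s (by simp) (by simp; positivity)
    (by simp)
  have h3 : ContinuousAt (fun s : ℝ => (s : ℂ)) s := by fun_prop
  exact (ContinuousAt.comp (f := fun s : ℝ => (s : ℂ)) h1 h3).sub
    (ContinuousAt.comp (f := fun s : ℝ => (s : ℂ)) h2 h3)

/-- decay rate -/
noncomputable def c0 (p : ℝ) : ℝ := Real.pi * (√2 / 2) / p

lemma c0_pos (p : ℝ) (hp : 0 < p) : 0 < c0 p := by unfold c0; positivity

lemma hh_line_bound (p a : ℝ) (hp : 0 < p) (ha : 0 < a) (ha2 : a < 2 * p) :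
    ∃ C : ℝ, 0 < C ∧ ∀ s : ℝ, ‖hh p a (W * s)‖ ≤ C * Real.exp (-(c0 p * |s|)) := by
  have hc := c0_pos p hp
  have hcont : Continuous fun s : ℝ => ‖hh p a (W * s)‖ * Real.exp (c0 p * |s|) := by
    have := hh_cont_line p a hp ha ha2
    fun_prop
  obtain ⟨C, hC⟩ := (isCompact_Icc (a := -(1 / c0 p)) (b := 1 / c0 p)).exists_bound_of_continuousOn
    hcont.continuousOn
  refine ⟨max C 8, by positivity, fun s => ?_⟩
  by_cases hs : s ∈ Set.Icc (-(1 / c0 p)) (1 / c0 p)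
  · have h1 := hC s hs
    rw [Real.norm_of_nonneg (by positivity)] at h1
    rw [Real.exp_neg, ← div_eq_mul_inv, le_div_iff₀ (Real.exp_pos _)]
    exact h1.trans (le_max_left _ _)
  · have h1 : 1 ≤ c0 p * |s| := by
      by_contra hcon
      push Not at hcon
      apply hs
      have : |s| ≤ 1 / c0 p := by
        rw [le_div_iff₀ hc]; linarith
      exact abs_le.1 this
    have e : |Real.pi * (W * s).re / p| = c0 p * |s| := by
      rw [W_re]
      simp only [Complex.ofReal_re, Complex.ofReal_im, add_zero]
      rw [show Real.pi * (√2 / 2 * s) / p = c0 p * s by unfold c0; ring, abs_mul, abs_of_pos hc]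
    have := hh_bound p a hp (W * s) (by rw [e]; exact h1)
    rw [e] at this
    exact this.trans (by gcongr; exact le_max_right _ _)

lemma integrable_exp_abs (d : ℝ) (hd : 0 < d) :
    MeasureTheory.Integrable fun s : ℝ => Real.exp (-(d * |s|)) := by
  have hb := (integrable_inv_one_add_sq).const_mul (max 1 (2 / d ^ 2))
  refine hb.mono' (by fun_prop) (Filter.Eventually.of_forall fun s => ?_)
  rw [Real.norm_of_nonneg (Real.exp_pos _).le, Real.exp_neg, ← div_eq_mul_inv,
    le_div_iff₀ (by positivity), inv_mul_le_iff₀ (Real.exp_pos _)]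
  have h := Real.quadratic_le_exp_of_nonneg (x := d * |s|) (by positivity)
  have h1 : 1 + s ^ 2 ≤ max 1 (2 / d ^ 2) * (1 + (d * |s|) ^ 2 / 2) := by
    rw [mul_pow, sq_abs]
    have m1 := le_max_left 1 (2 / d ^ 2)
    have m2 := le_max_right 1 (2 / d ^ 2)
    rw [div_le_iff₀ (by positivity)] at m2
    nlinarith [sq_nonneg s]
  have h2 : 0 ≤ d * |s| := by positivity
  calc _ ≤ _ := h1
    _ ≤ max 1 (2 / d ^ 2) * Real.exp (d * |s|) := by gcongr; linarith
    _ = _ := by ring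

lemma line_integrable (p a : ℝ) (hp : 0 < p) (ha : 0 < a) (ha2 : a < 2 * p) (E : ℂ → ℂ)
    (hE : Continuous fun s : ℝ => E (W * s)) (C : ℝ)
    (hC : ∀ s : ℝ, ‖E (W * s)‖ ≤ C * Real.exp (c0 p / 2 * |s|)) :
    MeasureTheory.Integrable fun s : ℝ => E (W * s) * hh p a (W * s) := by
  obtain ⟨D, hD, hD2⟩ := hh_line_bound p a hp ha ha2
  have hc := c0_pos p hp
  refine ((integrable_exp_abs (c0 p / 2) (by positivity)).const_mul (C * D)).mono'
    (hE.mul (hh_cont_line p a hp ha ha2)).aestronglyMeasurable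
    (Filter.Eventually.of_forall fun s => ?_)
  rw [norm_mul]
  calc _ ≤ (C * Real.exp (c0 p / 2 * |s|)) * (D * Real.exp (-(c0 p * |s|))) := by
        gcongr
        · exact (norm_nonneg _).trans (hC s)
        · exact hC s
        · exact hD2 s
    _ = C * D * (Real.exp (c0 p / 2 * |s|) * Real.exp (-(c0 p * |s|))) := by ring
    _ = _ := by rw [← Real.exp_add]; congr 2; ring

lemma rectI_sub (f g : ℂ → ℂ) (x0 x1 y0 y1 : ℝ)
    (hf : ∀ z : ℂ, z.re ∈ Set.uIcc x0 x1 → z.im ∈ Set.uIcc y0 y1 →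
      (z.im = y0 ∨ z.im = y1 ∨ z.re = x0 ∨ z.re = x1) → ContinuousAt f z)
    (hg : ∀ z : ℂ, z.re ∈ Set.uIcc x0 x1 → z.im ∈ Set.uIcc y0 y1 →
      (z.im = y0 ∨ z.im = y1 ∨ z.re = x0 ∨ z.re = x1) → ContinuousAt g z) :
    rectI (fun z => f z - g z) x0 x1 y0 y1 = rectI f x0 x1 y0 y1 - rectI g x0 x1 y0 y1 := by
  have key : ∀ f : ℂ → ℂ, (∀ z : ℂ, z.re ∈ Set.uIcc x0 x1 → z.im ∈ Set.uIcc y0 y1 →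
      (z.im = y0 ∨ z.im = y1 ∨ z.re = x0 ∨ z.re = x1) → ContinuousAt f z) →
      (∀ y : ℝ, (y = y0 ∨ y = y1) →
        IntervalIntegrable (fun x : ℝ => f (x + y * I)) MeasureTheory.volume x0 x1) ∧
      (∀ x : ℝ, (x = x0 ∨ x = x1) →
        IntervalIntegrable (fun y : ℝ => f (x + y * I)) MeasureTheory.volume y0 y1) := by
    intro f hf
    constructor
    · intro y hy
      apply ContinuousOn.intervalIntegrable
      intro x hx
      apply ContinuousAt.continuousWithinAt
      apply ContinuousAt.comp (f := fun x : ℝ => (x + y * I : ℂ)) _ (by fun_prop)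
      apply hf
      · simpa using hx
      · rcases hy with rfl | rfl <;> simp
      · rcases hy with rfl | rfl <;> simp
    · intro x hx
      apply ContinuousOn.intervalIntegrable
      intro y hy
      apply ContinuousAt.continuousWithinAt
      apply ContinuousAt.comp (f := fun y : ℝ => (x + y * I : ℂ)) _ (by fun_prop)
      apply hf
      · rcases hx with rfl | rfl <;> simp
      · simpa using hy
      · rcases hx with rfl | rfl <;> simp
  obtain ⟨f1, f2⟩ := key f hf
  obtain ⟨g1, g2⟩ := key g hg
  unfold rectI
  rw [intervalIntegral.integral_sub (f1 y0 (by simp)) (g1 y0 (by simp)),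
    intervalIntegral.integral_sub (f1 y1 (by simp)) (g1 y1 (by simp)),
    intervalIntegral.integral_sub (f2 x0 (by simp)) (g2 x0 (by simp)),
    intervalIntegral.integral_sub (f2 x1 (by simp)) (g2 x1 (by simp))]
  ring

/-- growth class -/
def Good (p : ℝ) (E : ℂ → ℂ) : Prop :=
  Differentiable ℂ E ∧ ∃ C : ℝ, 0 < C ∧ ∀ z : ℂ, 0 ≤ z.im → z.im ≤ √2 * p →
    ‖E (W * z)‖ ≤ C * Real.exp (c0 p / 2 * |z.re|)

lemma Good.integrable {p : ℝ} {E : ℂ → ℂ} (h : Good p E) (a : ℝ) (hp : 0 < p) (ha : 0 < a)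
    (ha2 : a < 2 * p) : MeasureTheory.Integrable fun s : ℝ => E (W * s) * hh p a (W * s) := by
  obtain ⟨h1, C, -, hC⟩ := h
  refine line_integrable p a hp ha ha2 E ?_ C ?_
  · have := h1.continuous
    fun_prop
  · intro s
    simpa using hC s (by simp) (by simp; positivity)

lemma shift_eq (p : ℝ) (s : ℝ) :
    W * (s + (√2 * p : ℝ) * I) = W * ((s + √2 * p : ℝ) : ℂ) + 2 * p * I := by
  have h2 : √2 ^ 2 = 2 := Real.sq_sqrt (by norm_num)
  apply Complex.ext
  · rw [Complex.add_re, W_re, W_re]; simp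
  · rw [Complex.add_im, W_im, W_im]; simp; linear_combination p * h2

lemma Good.integrable_shift {p : ℝ} {E : ℂ → ℂ} (h : Good p E) (a : ℝ) (hp : 0 < p) (ha : 0 < a)
    (ha2 : a < 2 * p) :
    MeasureTheory.Integrable fun s : ℝ => E (W * s + 2 * p * I) * hh p a (W * s) := by
  obtain ⟨h1, C, hC0, hC⟩ := h
  have hc := c0_pos p hp
  refine line_integrable p a hp ha ha2 (fun x => E (x + 2 * p * I)) ?_
    (C * Real.exp (c0 p / 2 * (√2 * p))) ?_
  · have := h1.continuous
    fun_prop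
  · intro s
    have e := shift_eq p (s - √2 * p)
    rw [show s - √2 * p + √2 * p = s by ring] at e
    rw [← e]
    refine (hC _ (by simp; positivity) (by simp)).trans ?_
    rw [mul_assoc, ← Real.exp_add]
    gcongr
    simp only [Complex.add_re, Complex.ofReal_re, Complex.re_ofReal_mul, I_re, mul_zero, add_zero]
    have : |s - √2 * p| ≤ |s| + √2 * p := by
      refine (abs_sub _ _).trans ?_
      rw [abs_of_pos (a := √2 * p) (by positivity)]
    nlinarith

lemma vert_bound {p : ℝ} {E : ℂ → ℂ} (h : Good p E) (a : ℝ) (hp : 0 < p) :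
    ∃ D : ℝ, ∀ R : ℝ, √2 * p + 1 / c0 p ≤ |R| →
      ‖∫ y : ℝ in 0..(√2 * p), E (W * (R + y * I)) * hh p a (W * (R + y * I))‖ ≤
        D * Real.exp (-(c0 p / 2 * |R|)) := by
  obtain ⟨h1, C, hC0, hC⟩ := h
  have hc := c0_pos p hp
  have hY : 0 < √2 * p := by positivity
  refine ⟨C * 8 * Real.exp (c0 p * (√2 * p)) * (√2 * p), fun R hR => ?_⟩
  have : ∀ y ∈ Set.uIoc 0 (√2 * p), ‖E (W * (R + y * I)) * hh p a (W * (R + y * I))‖ ≤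
      C * 8 * Real.exp (c0 p * (√2 * p)) * Real.exp (-(c0 p / 2 * |R|)) := by
    intro y hy
    rw [Set.uIoc_of_le hY.le] at hy
    have b1 := hC (R + y * I) (by simpa using hy.1.le) (by simpa using hy.2)
    have e : |Real.pi * (W * (R + y * I)).re / p| = c0 p * |R + y| := by
      have : Real.pi * (W * (R + y * I)).re / p = c0 p * (R + y) := by
        rw [W_re]; simp [c0]; ring
      rw [this, abs_mul, abs_of_pos hc]
    have b : |R| - √2 * p ≤ |R + y| := by
      have := abs_sub (R + y) y
      rw [add_sub_cancel_right, abs_of_pos hy.1] at this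
      linarith [hy.2]
    have b0 : 1 ≤ c0 p * (|R| - √2 * p) := by
      have : 1 / c0 p ≤ |R| - √2 * p := by linarith
      rw [div_le_iff₀ hc] at this
      linarith
    have b3 : c0 p * (|R| - √2 * p) ≤ c0 p * |R + y| := by gcongr
    have b2 := hh_bound p a hp (W * (R + y * I)) (by rw [e]; linarith)
    rw [e] at b2
    rw [norm_mul]
    simp only [Complex.add_re, Complex.ofReal_re, Complex.re_ofReal_mul, I_re, mul_zero, add_zero] at b1
    calc _ ≤ (C * Real.exp (c0 p / 2 * |R|)) * (8 * Real.exp (-(c0 p * (|R| - √2 * p)))) := by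
          gcongr
          refine b2.trans ?_
          gcongr
      _ = C * 8 * (Real.exp (c0 p / 2 * |R|) * Real.exp (-(c0 p * (|R| - √2 * p)))) := by ring
      _ = _ := by
        rw [mul_assoc (C * 8), ← Real.exp_add, ← Real.exp_add]
        congr 2; ring
  have := intervalIntegral.norm_integral_le_of_norm_le_const this
  rw [sub_zero, abs_of_pos hY] at this
  refine this.trans (le_of_eq (by ring))

lemma vert_tendsto {p : ℝ} {E : ℂ → ℂ} (h : Good p E) (a : ℝ) (hp : 0 < p) (σ : ℝ) (hσ : |σ| = 1) :
    Filter.Tendsto (fun R : ℝ => ∫ y : ℝ in 0..(√2 * p), E (W * ((σ * R : ℝ) + y * I)) *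
      hh p a (W * ((σ * R : ℝ) + y * I))) Filter.atTop (nhds 0) := by
  obtain ⟨D, hD⟩ := vert_bound h a hp
  have hc := c0_pos p hp
  apply squeeze_zero_norm' (a := fun R => D * Real.exp (-(c0 p / 2 * R)))
  · filter_upwards [Filter.eventually_ge_atTop (√2 * p + 1 / c0 p), Filter.eventually_ge_atTop 0]
      with R h1 h2
    have : |σ * R| = R := by rw [abs_mul, hσ, one_mul, abs_of_nonneg h2]
    have := hD (σ * R) (by rw [this]; exact h1)
    rwa [abs_mul, hσ, one_mul, abs_of_nonneg h2] at this
  · have : Filter.Tendsto (fun R : ℝ => c0 p / 2 * R) Filter.atTop Filter.atTop :=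
      Filter.tendsto_id.const_mul_atTop (by positivity)
    have := (Real.tendsto_exp_neg_atTop_nhds_zero.comp this).const_mul D
    simpa using this

lemma master {p : ℝ} {E : ℂ → ℂ} (h : Good p E) (a : ℝ) (hp : 0 < p) (ha : 0 < a)
    (ha2 : a < 2 * p) :
    (∫ s : ℝ, E (W * s) * hh p a (W * s)) - ∫ s : ℝ, E (W * s + 2 * p * I) * hh p a (W * s) =
      2 * I * p / W * (E (a * I) - E ((2 * p - a : ℝ) * I)) := by
  have hY : 0 < √2 * p := by positivity
  have hpi : (Real.pi : ℂ) ≠ 0 := by exact_mod_cast Real.pi_ne_zero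
  have hW := W_ne
  set F : ℂ → ℂ := fun z => E (W * z) * hh p a (W * z) with hF
  have hFi1 : MeasureTheory.Integrable fun s : ℝ => F s := h.integrable a hp ha ha2
  have hFi2 := h.integrable_shift a hp ha ha2
  have etop : (fun s : ℝ => F (s + (√2 * p : ℝ) * I)) =
      fun s : ℝ => (fun s : ℝ => E (W * s + 2 * p * I) * hh p a (W * s)) (s + √2 * p) := by
    ext s
    simp only [hF]
    rw [shift_eq, hh_periodic p a hp]
  have hFi3 : MeasureTheory.Integrable fun s : ℝ => F (s + (√2 * p : ℝ) * I) := by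
    rw [etop]; exact hFi2.comp_add_right _
  have eint : ∫ s : ℝ, F (s + (√2 * p : ℝ) * I) = ∫ s : ℝ, E (W * s + 2 * p * I) * hh p a (W * s) := by
    rw [etop]
    exact MeasureTheory.integral_add_right_eq_self
      (fun s : ℝ => E (W * s + 2 * p * I) * hh p a (W * s)) _
  rw [← eint]
  have t1 := MeasureTheory.intervalIntegral_tendsto_integral hFi1 Filter.tendsto_neg_atTop_atBot
    Filter.tendsto_id
  have t2 := MeasureTheory.intervalIntegral_tendsto_integral hFi3 Filter.tendsto_neg_atTop_atBot
    Filter.tendsto_id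
  have t3 := vert_tendsto h a hp 1 (by simp)
  have t4 := vert_tendsto h a hp (-1) (by simp)
  have T := ((t1.sub t2).add (t3.const_mul I)).sub (t4.const_mul I)
  have T' : Filter.Tendsto (fun R : ℝ => rectI F (-R) R 0 (√2 * p)) Filter.atTop
      (nhds ((∫ s : ℝ, F s) - (∫ s : ℝ, F (s + (√2 * p : ℝ) * I)) + I * 0 - I * 0)) := by
    refine T.congr fun R => ?_
    unfold rectI
    simp [hF]
  have T2 : Filter.Tendsto (fun R : ℝ => rectI F (-R) R 0 (√2 * p)) Filter.atTop
      (nhds (2 * I * p / W * (E (a * I) - E ((2 * p - a : ℝ) * I)))) := by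
    apply tendsto_const_nhds.congr'
    filter_upwards [Filter.eventually_gt_atTop (2 * p)] with R hR
    have hcont : ∀ c : ℝ, 0 < c → c < 2 * p → ∀ z : ℂ, z.re ∈ Set.uIcc (-R) R →
        z.im ∈ Set.uIcc 0 (√2 * p) →
        (z.im = 0 ∨ z.im = √2 * p ∨ z.re = -R ∨ z.re = R) →
        ContinuousAt (fun z => E (W * z) * ph p (W * z - c * I)) z := by
      intro c hc hc2 z _ hz hz2
      rw [Set.uIcc_of_le hY.le] at hz
      have c1 := ph_cont p hp c hc hc2 z hz.1 hz.2 (by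
        rcases hz2 with h | h | h | h
        · exact Or.inl h
        · exact Or.inr (Or.inl h)
        · right; right; rw [h, abs_neg, abs_of_pos (by linarith)]; exact hR
        · right; right; rw [h, abs_of_pos (by linarith)]; exact hR)
      have := h.1.continuous
      exact ContinuousAt.mul (by fun_prop) c1
    have e : F = fun z => E (W * z) * ph p (W * z - a * I) -
        E (W * z) * ph p (W * z - (2 * p - a : ℝ) * I) := by
      ext z; simp only [hF, hh]; ring
    rw [e, rectI_sub _ _ _ _ _ _ (hcont a ha ha2) (hcont (2 * p - a) (by linarith) (by linarith)),
      rectI_ph p hp a ha ha2 E h.1 R hR,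
      rectI_ph p hp (2 * p - a) (by linarith) (by linarith) E h.1 R hR]
    field_simp
  have := tendsto_nhds_unique T' T2
  rw [← this]
  simp only [hF, mul_zero, add_zero, sub_zero]

lemma poly_bound (p : ℝ) (hp : 0 < p) (Q : Polynomial ℂ) :
    ∃ C : ℝ, 0 < C ∧ ∀ z : ℂ, 0 ≤ z.im → z.im ≤ √2 * p →
      ‖Q.eval (W * z)‖ ≤ C * Real.exp (c0 p / 2 * |z.re|) := by
  have hc := c0_pos p hp
  induction Q using Polynomial.induction_on' with
  | add f g hf hg =>
    obtain ⟨C, hC, h1⟩ := hf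
    obtain ⟨D, hD, h2⟩ := hg
    refine ⟨C + D, by positivity, fun z hz hz2 => ?_⟩
    rw [Polynomial.eval_add, add_mul]
    exact (norm_add_le _ _).trans (add_le_add (h1 z hz hz2) (h2 z hz hz2))
  | monomial n a =>
    set d := c0 p / 2 with hd
    have hdp : 0 < d := by positivity
    refine ⟨(‖a‖ + 1) * (Nat.factorial n / d ^ n * Real.exp (d * (√2 * p))), by positivity,
      fun z hz hz2 => ?_⟩
    rw [Polynomial.eval_monomial, norm_mul, norm_pow, norm_mul, norm_W, one_mul]
    have h1 := Real.pow_div_factorial_le_exp (x := d * ‖z‖) (by positivity) n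
    rw [div_le_iff₀ (by positivity), mul_pow] at h1
    have h2 : ‖z‖ ≤ |z.re| + √2 * p := by
      refine (Complex.norm_le_abs_re_add_abs_im z).trans ?_
      rw [abs_of_nonneg hz]; linarith
    have h3 : ‖z‖ ^ n ≤ Nat.factorial n / d ^ n * Real.exp (d * ‖z‖) := by
      rw [div_mul_eq_mul_div, le_div_iff₀ (by positivity)]
      linarith
    have h4 : Real.exp (d * ‖z‖) ≤ Real.exp (d * (√2 * p)) * Real.exp (d * |z.re|) := by
      rw [← Real.exp_add]
      gcongr
      nlinarith
    calc ‖a‖ * ‖z‖ ^ n ≤ (‖a‖ + 1) * (Nat.factorial n / d ^ n *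
          (Real.exp (d * (√2 * p)) * Real.exp (d * |z.re|))) := by
          gcongr
          · linarith
          · refine h3.trans ?_
            gcongr
      _ = _ := by ring

lemma good_poly (p : ℝ) (hp : 0 < p) (Q : Polynomial ℂ) : Good p (fun x => Q.eval x) :=
  ⟨Q.differentiable, poly_bound p hp Q⟩

lemma good_gauss (p : ℝ) (hp : 0 < p) (Q : Polynomial ℂ) (d M : ℝ) (hd : 0 ≤ d) (hM : 0 < M) :
    Good p (fun x => Complex.exp (-(Real.pi * I / M) * (x + d * I) ^ 2) * Q.eval x) := by
  refine ⟨by have := Q.differentiable; fun_prop, ?_⟩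
  obtain ⟨C, hC, h⟩ := poly_bound p hp Q
  refine ⟨Real.exp (2 * Real.pi / M * (2 * p ^ 2 + d * (√2 / 2) * (√2 * p) + d ^ 2)) * C,
    by positivity, fun z hz hz2 => ?_⟩
  rw [norm_mul, mul_assoc]
  gcongr
  · rw [Complex.norm_exp]
    gcongr
    set x := W * z + d * I with hx
    have e : (-(Real.pi * I / M) * x ^ 2 : ℂ).re = 2 * Real.pi / M * (x.re * x.im) := by
      have : (-(Real.pi * I / M) * x ^ 2 : ℂ) = ((Real.pi / M : ℝ) : ℂ) * (-I * x ^ 2) := by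
        push_cast; ring
      rw [this, Complex.re_ofReal_mul]
      simp [sq]; ring
    rw [e]
    gcongr
    have h2 : √2 ^ 2 = 2 := Real.sq_sqrt (by norm_num)
    have h2p : 0 < √2 := by positivity
    rw [hx, Complex.add_re, Complex.add_im, W_re, W_im]
    simp only [Complex.re_ofReal_mul, Complex.im_ofReal_mul, I_re, I_im, mul_zero, mul_one, add_zero]
    have e2 : √2 / 2 * (z.re + z.im) * (√2 / 2 * (z.im - z.re) + d) =
        (z.im ^ 2 - z.re ^ 2) / 2 + d * (√2 / 2) * z.im + d * (√2 / 2) * z.re := by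
      linear_combination ((z.im ^ 2 - z.re ^ 2) / 4) * h2
    rw [e2]
    have e3 : z.im ^ 2 ≤ 2 * p ^ 2 := by
      calc z.im ^ 2 ≤ (√2 * p) ^ 2 := by gcongr
        _ = _ := by rw [mul_pow, h2]
    have e4 : d * (√2 / 2) * z.im ≤ d * (√2 / 2) * (√2 * p) := by gcongr
    have e5 : d * (√2 / 2) * z.re ≤ z.re ^ 2 / 2 + d ^ 2 / 4 := by
      nlinarith [sq_nonneg (z.re - d * (√2 / 2))]
    nlinarith [sq_nonneg d]
  · exact h z hz hz2

lemma psi_block (p a : ℤ) (ha : 0 < a) (hap : a < p) (m : ℤ) (f : ℤ → ℂ) :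
    ∑ k ∈ Finset.Icc (2 * p * m + 1) (2 * p * m + 2 * p), (psi p a k : ℂ) * f k =
      f (a + 2 * p * m) - f (2 * p - a + 2 * p * m) := by
  have hne : a + 2 * p * m ≠ 2 * p - a + 2 * p * m := by intro h; linarith
  have h1 : psi p a (a + 2 * p * m) = 1 := by
    unfold psi
    rw [if_pos]
    simp [Int.ModEq]
  have hlt : ∀ d : ℤ, 2 * p ∣ d → 0 ≤ d → d < 2 * p → d = 0 := by
    intro d h1 h2 h3
    exact Int.eq_zero_of_dvd_of_nonneg_of_lt h2 h3 h1
  have h2 : psi p a (2 * p - a + 2 * p * m) = -1 := by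
    unfold psi
    rw [if_neg, if_pos]
    · apply Int.ModEq.symm
      rw [Int.modEq_iff_dvd]
      exact ⟨1 + m, by ring⟩
    · intro h
      have h := (Int.modEq_iff_dvd.1 h.symm)
      have : (2 * p) ∣ (2 * p - 2 * a) := by
        obtain ⟨c, hc⟩ := h
        exact ⟨c - m, by linear_combination hc⟩
      have := hlt _ this (by linarith) (by linarith)
      linarith
  rw [← Finset.sum_subset (s₁ := {a + 2 * p * m, 2 * p - a + 2 * p * m})]
  · rw [Finset.sum_pair hne, h1, h2]; push_cast; ring
  · intro x hx
    simp only [Finset.mem_insert, Finset.mem_singleton] at hx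
    rw [Finset.mem_Icc]
    rcases hx with rfl | rfl <;> constructor <;> linarith
  · intro x hx hx2
    simp only [Finset.mem_insert, Finset.mem_singleton, not_or] at hx2
    rw [Finset.mem_Icc] at hx
    have : psi p a x = 0 := by
      unfold psi
      rw [if_neg, if_neg]
      · intro h
        obtain ⟨c, hc⟩ := (Int.modEq_iff_dvd.1 h.symm)
        apply hx2.2
        have d1 : 2 * p ∣ x + a - 2 * p * m - 2 * p := ⟨c - m - 1, by linear_combination hc⟩
        rcases le_or_gt 0 (x + a - 2 * p * m - 2 * p) with h0 | h0
        · have := hlt _ d1 h0 (by linarith)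
          linarith
        · have := hlt (-(x + a - 2 * p * m - 2 * p)) (by rwa [dvd_neg]) (by linarith) (by linarith)
          linarith
      · intro h
        obtain ⟨c, hc⟩ := (Int.modEq_iff_dvd.1 h.symm)
        apply hx2.1
        have d1 : 2 * p ∣ x - a - 2 * p * m := ⟨c - m, by linear_combination hc⟩
        rcases le_or_gt 0 (x - a - 2 * p * m) with h0 | h0
        · have := hlt _ d1 h0 (by linarith)
          linarith
        · have := hlt (-(x - a - 2 * p * m)) (by rwa [dvd_neg]) (by linarith) (by linarith)
          linarith
    rw [this]; simp

lemma psi_sum (p a : ℤ) (ha : 0 < a) (hap : a < p) (N : ℕ) (f : ℤ → ℂ) :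
    ∑ k ∈ Finset.Icc (1 : ℤ) (2 * p * N), (psi p a k : ℂ) * f k =
      ∑ m ∈ Finset.range N, (f (a + 2 * p * m) - f (2 * p - a + 2 * p * m)) := by
  induction N with
  | zero => simp
  | succ n ih =>
    rw [Finset.sum_range_succ, ← ih, ← psi_block p a ha hap, ← Finset.sum_union]
    · apply Finset.sum_congr _ (fun _ _ => rfl)
      ext k
      have : 0 ≤ 2 * p * (n : ℤ) := by have := ha.trans hap; positivity
      simp only [Finset.mem_union, Finset.mem_Icc]
      push_cast
      constructor
      · rintro ⟨h1, h2⟩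
        rcases le_or_gt k (2 * p * n) with h | h
        · left; exact ⟨h1, h⟩
        · right; exact ⟨by linarith, by linarith⟩
      · rintro (⟨h1, h2⟩ | ⟨h1, h2⟩) <;> constructor <;> linarith
    · rw [Finset.disjoint_left]
      intro k h1 h2
      rw [Finset.mem_Icc] at h1 h2
      linarith [h1.2, h2.1]

lemma moment (p a : ℤ) (ha : 0 < a) (hap : a < p) (k : ℕ) :
    ∫ s : ℝ, (W * s) ^ (2 * k) * hh p a (W * s) = 2 * I * p / W * ((-1) ^ k * Lval p a (2 * k)) := by
  have hp0 : 0 < p := ha.trans hap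
  have hp : (0 : ℝ) < p := by exact_mod_cast hp0
  have hpc : (p : ℂ) ≠ 0 := by exact_mod_cast hp.ne'
  have haR : (0 : ℝ) < a := by exact_mod_cast ha
  have hapR : (a : ℝ) < p := by exact_mod_cast hap
  have hW := W_ne
  set B : ℂ → ℂ := fun t => Polynomial.aeval t (Polynomial.bernoulli (2 * k + 1)) with hB
  have hB1 : ∀ t, B (1 + t) = B t + (2 * k + 1) * t ^ (2 * k) := by
    intro t
    have := Polynomial.bernoulli_comp_one_add_X (2 * k + 1)
    have := congrArg (Polynomial.aeval t) this
    have h2 : (Polynomial.aeval t) (2 : Polynomial ℚ) = 2 := map_ofNat _ 2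
    simpa [Polynomial.aeval_comp, h2] using this
  have hBQ : ∀ q : ℚ, B q = (((Polynomial.bernoulli (2 * k + 1)).eval q : ℚ) : ℂ) := by
    intro q
    simp only [hB]
    have := Polynomial.aeval_algebraMap_apply ℂ q (Polynomial.bernoulli (2 * k + 1))
    simpa using this
  set Q : Polynomial ℂ := ((Polynomial.bernoulli (2 * k + 1)).map (algebraMap ℚ ℂ)).comp
    (Polynomial.C (1 / (2 * p * I)) * Polynomial.X) with hQ
  have hQe : ∀ x, Q.eval x = B (x / (2 * p * I)) := by
    intro x
    simp only [hQ, hB, Polynomial.eval_comp, Polynomial.eval_map_algebraMap, Polynomial.eval_mul,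
      Polynomial.eval_C, Polynomial.eval_X]
    congr 2; ring
  have hm := master (good_poly p hp Q) a hp haR (by linarith)
  have hg := (good_poly p hp Q).integrable a hp haR (by linarith)
  have hg2 := (good_poly p hp Q).integrable_shift a hp haR (by linarith)
  rw [← MeasureTheory.integral_sub hg hg2] at hm
  have e1 : ∀ s : ℝ, Polynomial.eval (W * s) Q * hh p a (W * s) -
      Polynomial.eval (W * s + 2 * (p : ℝ) * I) Q * hh p a (W * s) =
      (-(2 * k + 1) / (2 * p * I) ^ (2 * k)) * ((W * s) ^ (2 * k) * hh p a (W * s)) := by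
    intro s
    rw [hQe, hQe]
    have : (W * s + 2 * (p : ℝ) * I) / (2 * p * I) = 1 + W * s / (2 * p * I) := by
      push_cast; field_simp; ring
    rw [this, hB1, div_pow]
    ring
  simp only [e1] at hm
  rw [MeasureTheory.integral_const_mul] at hm
  have e2 : Q.eval (((a : ℝ) : ℂ) * I) - Q.eval (((2 * p - a : ℝ) : ℂ) * I) =
      ∑ l ∈ Finset.Icc (1 : ℤ) (2 * p), (psi p a l : ℂ) *
        (((Polynomial.bernoulli (2 * k + 1)).eval ((l : ℚ) / (2 * p)) : ℚ) : ℂ) := by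
    have := psi_sum p a ha hap 1
      (fun l => (((Polynomial.bernoulli (2 * k + 1)).eval ((l : ℚ) / (2 * p)) : ℚ) : ℂ))
    simp only [Nat.cast_one, mul_one, Finset.sum_range_one, Nat.cast_zero, mul_zero, add_zero] at this
    rw [this, hQe, hQe, ← hBQ, ← hBQ]
    congr 2
    · push_cast; field_simp
    · push_cast; field_simp
  have e3 : Lval p a (2 * k) = -((2 * p : ℂ) ^ (2 * k) / (2 * k + 1)) *
      (Q.eval (((a : ℝ) : ℂ) * I) - Q.eval (((2 * p - a : ℝ) : ℂ) * I)) := by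
    rw [e2, Lval]; push_cast; ring
  rw [e3]
  have h2k : (2 * k + 1 : ℂ) ≠ 0 := by exact_mod_cast Nat.succ_ne_zero (2 * k)
  have hpow : (2 * p * I : ℂ) ^ (2 * k) = (2 * p) ^ (2 * k) * (-1) ^ k := by
    rw [mul_pow, pow_mul I, I_sq]
  have h1k : ((-1 : ℂ) ^ k) * (-1) ^ k = 1 := by rw [← mul_pow]; simp
  rw [hpow] at hm
  have hne : (2 * p : ℂ) ^ (2 * k) ≠ 0 := pow_ne_zero _ (by simpa using hpc)
  have hne2 : ((-1 : ℂ) ^ k) ≠ 0 := by simp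
  set J := ∫ s : ℝ, (W * s) ^ (2 * k) * hh p a (W * s)
  set Δ := (Q.eval (((a : ℝ) : ℂ) * I) - Q.eval (((2 * p - a : ℝ) : ℂ) * I))
  have : J = -((2 * p : ℂ) ^ (2 * k) * (-1) ^ k) / (2 * k + 1) *
    (-(2 * k + 1) / ((2 * p) ^ (2 * k) * (-1) ^ k) * J) := by field_simp
  rw [this, hm]
  push_cast
  ring

lemma exp_taylor_bound (n : ℕ) (y : ℝ) (hy : 0 ≤ y) :
    ‖Complex.exp (-y) - ∑ k ∈ Finset.range n, (-y : ℂ) ^ k / (Nat.factorial k : ℂ)‖ ≤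
      (n + 4) * y ^ n := by
  rcases le_total y 1 with h | h
  · have := Complex.norm_exp_sub_sum_le_norm_mul_exp (-y : ℂ) n
    rw [norm_neg, Complex.norm_real, Real.norm_of_nonneg hy] at this
    refine this.trans ?_
    have h1 : Real.exp y ≤ 4 := by
      have : Real.exp y ≤ Real.exp 1 := by gcongr
      linarith [Real.exp_one_lt_d9]
    have h2 : 0 ≤ y ^ n := by positivity
    have h3 : (0 : ℝ) ≤ n := by positivity
    nlinarith [mul_nonneg h3 h2]
  · have h1 : ‖Complex.exp (-y)‖ ≤ 1 := by
      rw [Complex.norm_exp]; simp; linarith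
    have h2 : ‖∑ k ∈ Finset.range n, (-y : ℂ) ^ k / (Nat.factorial k : ℂ)‖ ≤ n * y ^ n := by
      refine (norm_sum_le _ _).trans ?_
      have : ∀ k ∈ Finset.range n, ‖(-y : ℂ) ^ k / (Nat.factorial k : ℂ)‖ ≤ y ^ n := by
        intro k hk
        rw [norm_div, norm_pow, norm_neg, Complex.norm_real, Real.norm_of_nonneg hy,
          Complex.norm_natCast]
        have f1 : (1 : ℝ) ≤ Nat.factorial k := by exact_mod_cast Nat.factorial_pos k
        calc y ^ k / Nat.factorial k ≤ y ^ k := div_le_self (by positivity) f1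
          _ ≤ y ^ n := pow_le_pow_right₀ h (Finset.mem_range.1 hk).le
      simpa using Finset.sum_le_sum this
    have h3 : 1 ≤ y ^ n := one_le_pow₀ h
    refine (norm_sub_le _ _).trans ?_
    linarith

lemma asymp (p a : ℤ) (ha : 0 < a) (hap : a < p) (K : ℕ) :
    ∃ C : ℝ, ∀ N : ℕ, 0 < N →
      ‖(∫ s : ℝ, Complex.exp (-(Real.pi * I / (2 * p * N : ℝ)) * (W * s) ^ 2) * hh p a (W * s)) -
        ∑ k ∈ Finset.range (K + 1), (-(Real.pi * I / (2 * p * N : ℝ))) ^ k / (Nat.factorial k : ℂ) *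
          ∫ s : ℝ, (W * s) ^ (2 * k) * hh p a (W * s)‖ ≤ C / (N : ℝ) ^ (K + 1) := by
  have hp0 : 0 < p := ha.trans hap
  have hp : (0 : ℝ) < p := by exact_mod_cast hp0
  have haR : (0 : ℝ) < a := by exact_mod_cast ha
  have hapR : (a : ℝ) < p := by exact_mod_cast hap
  have hmon : ∀ n : ℕ, MeasureTheory.Integrable fun s : ℝ => (W * s) ^ n * hh p a (W * s) := by
    intro n
    have := (good_poly p hp (Polynomial.X ^ n)).integrable a hp haR (by linarith)
    simpa using this
  set D := ∫ s : ℝ, ‖(W * s) ^ (2 * (K + 1)) * hh p a (W * s)‖ with hD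
  refine ⟨((K + 1 : ℕ) + 4) * (Real.pi / (2 * p)) ^ (K + 1) * D, fun N hN => ?_⟩
  have hNR : (0 : ℝ) < N := by exact_mod_cast hN
  set M : ℝ := 2 * p * N with hM
  have hMp : 0 < M := by positivity
  have hg : MeasureTheory.Integrable fun s : ℝ =>
      Complex.exp (-(Real.pi * I / M) * (W * s) ^ 2) * hh p a (W * s) := by
    have := (good_gauss p hp (Polynomial.C 1) 0 M le_rfl hMp).integrable a hp haR (by linarith)
    simpa using this
  simp_rw [← MeasureTheory.integral_const_mul]
  rw [← MeasureTheory.integral_finsetSum _ (fun k _ => (hmon (2 * k)).const_mul _),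
    ← MeasureTheory.integral_sub hg
      (MeasureTheory.integrable_finsetSum _ (fun k _ => (hmon (2 * k)).const_mul _))]
  have hb : ∀ s : ℝ, ‖Complex.exp (-(Real.pi * I / M) * (W * s) ^ 2) * hh p a (W * s) -
      ∑ k ∈ Finset.range (K + 1), (-(Real.pi * I / M)) ^ k / (Nat.factorial k : ℂ) *
        ((W * s) ^ (2 * k) * hh p a (W * s))‖ ≤
      ((K + 1 : ℕ) + 4) * (Real.pi / M) ^ (K + 1) * ‖(W * s) ^ (2 * (K + 1)) * hh p a (W * s)‖ := by
    intro s
    have e : -(Real.pi * I / M) * (W * s) ^ 2 = -((Real.pi / M * s ^ 2 : ℝ) : ℂ) := by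
      rw [mul_pow, W_sq]; push_cast; linear_combination (Real.pi * s ^ 2 / M : ℂ) * I_sq
    have e2 : Complex.exp (-(Real.pi * I / M) * (W * s) ^ 2) * hh p a (W * s) -
      ∑ k ∈ Finset.range (K + 1), (-(Real.pi * I / M)) ^ k / (Nat.factorial k : ℂ) *
        ((W * s) ^ (2 * k) * hh p a (W * s)) =
        (Complex.exp (-((Real.pi / M * s ^ 2 : ℝ) : ℂ)) - ∑ k ∈ Finset.range (K + 1),
          (-((Real.pi / M * s ^ 2 : ℝ) : ℂ)) ^ k / (Nat.factorial k : ℂ)) * hh p a (W * s) := by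
      rw [← e, sub_mul, Finset.sum_mul]
      congr 1
      apply Finset.sum_congr rfl
      intro k _
      rw [mul_pow (-(Real.pi * I / M : ℂ)), ← pow_mul]; ring
    rw [e2, norm_mul, norm_mul, norm_pow, norm_mul, norm_W, one_mul, Complex.norm_real]
    have := exp_taylor_bound (K + 1) (Real.pi / M * s ^ 2) (by positivity)
    calc _ ≤ (((K + 1 : ℕ) : ℝ) + 4) * (Real.pi / M * s ^ 2) ^ (K + 1) * ‖hh p a (W * s)‖ := by
          gcongr
      _ = _ := by
        rw [mul_pow (Real.pi / M), pow_mul ‖s‖, Real.norm_eq_abs, sq_abs]; ring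
  refine (MeasureTheory.norm_integral_le_of_norm_le ((hmon (2 * (K + 1))).norm.const_mul _)
    (Filter.Eventually.of_forall hb)).trans (le_of_eq ?_)
  rw [MeasureTheory.integral_const_mul, ← hD, hM]
  rw [show Real.pi / (2 * p * N) = Real.pi / (2 * p) / (N : ℝ) by rw [div_div], div_pow _ (N : ℝ)]
  ring

lemma gauss_expand (d M : ℝ) (s : ℝ) :
    -(Real.pi * I / M) * (W * s + d * I) ^ 2 =
      (-(Real.pi / M : ℝ) : ℂ) * s ^ 2 + (2 * Real.pi * d / M * W) * s + Real.pi * I * d ^ 2 / M := by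
  have := W_sq
  have h3 : I ^ 3 = -I := by rw [pow_succ, I_sq]; ring
  push_cast
  linear_combination (-(Real.pi * I / M) * s ^ 2 : ℂ) * this + (Real.pi * s ^ 2 / M : ℂ) * I_sq
   - (Real.pi / M * 2 * W * s * d : ℂ) * I_sq - (Real.pi / M * d ^ 2 : ℂ) * h3

lemma gauss_integrable (d M : ℝ) (hM : 0 < M) :
    MeasureTheory.Integrable fun s : ℝ => Complex.exp (-(Real.pi * I / M) * (W * s + d * I) ^ 2) := by
  simp_rw [gauss_expand]
  apply integrable_cexp_quadratic'
  rw [← Complex.ofReal_neg, Complex.ofReal_re]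
  have : 0 < Real.pi / M := by positivity
  linarith

lemma gauss_integral (d M : ℝ) (hM : 0 < M) :
    ∫ s : ℝ, Complex.exp (-(Real.pi * I / M) * (W * s + d * I) ^ 2) = (√M : ℝ) := by
  have hMc : (M : ℂ) ≠ 0 := by exact_mod_cast hM.ne'
  have hpi : (Real.pi : ℂ) ≠ 0 := by exact_mod_cast Real.pi_ne_zero
  simp_rw [gauss_expand]
  rw [integral_cexp_quadratic]
  · have e1 : (Real.pi : ℂ) / -(-((Real.pi / M : ℝ) : ℂ)) = (M : ℝ) := by
      push_cast; field_simp
    have e2 : (Real.pi * I * d ^ 2 / M : ℂ) - (2 * Real.pi * d / M * W) ^ 2 /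
        (4 * -((Real.pi / M : ℝ) : ℂ)) = 0 := by
      rw [mul_pow, W_sq]; push_cast; field_simp; ring
    rw [e1, e2, Complex.exp_zero, mul_one, Real.sqrt_eq_rpow, Complex.ofReal_cpow hM.le]
    simp
  · rw [← Complex.ofReal_neg, Complex.ofReal_re]
    have : 0 < Real.pi / M := by positivity
    linarith

lemma gauss_integrable1 (d M : ℝ) (hM : 0 < M) :
    MeasureTheory.Integrable fun s : ℝ => (W * s + d * I) *
      Complex.exp (-(Real.pi * I / M) * (W * s + d * I) ^ 2) := by
  have hb : (-(Real.pi / M : ℝ) : ℂ).re < 0 := by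
    rw [← Complex.ofReal_neg, Complex.ofReal_re]
    have : 0 < Real.pi / M := by positivity
    linarith
  have h1 : MeasureTheory.Integrable fun s : ℝ => (s : ℂ) *
      Complex.exp (-(Real.pi * I / M) * (W * s + d * I) ^ 2) := by
    simp_rw [gauss_expand]
    have i1 := integrable_cexp_quadratic' hb (2 * Real.pi * d / M * W + 1) (Real.pi * I * d ^ 2 / M)
    have i2 := integrable_cexp_quadratic' hb (2 * Real.pi * d / M * W - 1) (Real.pi * I * d ^ 2 / M)
    refine (i1.norm.add i2.norm).mono' (by fun_prop) (Filter.Eventually.of_forall fun s => ?_)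
    simp only [Pi.add_apply]
    set X : ℂ := (-(Real.pi / M : ℝ) : ℂ) * s ^ 2 + (2 * Real.pi * d / M * W) * s +
      Real.pi * I * d ^ 2 / M with hX
    have e1 : (-(Real.pi / M : ℝ) : ℂ) * s ^ 2 + (2 * Real.pi * d / M * W + 1) * s +
      Real.pi * I * d ^ 2 / M = s + X := by rw [hX]; ring
    have e2 : (-(Real.pi / M : ℝ) : ℂ) * s ^ 2 + (2 * Real.pi * d / M * W - 1) * s +
      Real.pi * I * d ^ 2 / M = (-s : ℝ) + X := by rw [hX]; push_cast; ring
    rw [e1, e2]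
    clear_value X
    rw [Complex.exp_add, Complex.exp_add, norm_mul, norm_mul, norm_mul, ← add_mul,
      Complex.norm_exp_ofReal, Complex.norm_exp_ofReal, Complex.norm_real, Real.norm_eq_abs]
    gcongr
    have := Real.add_one_le_exp s
    have := Real.add_one_le_exp (-s)
    have := Real.exp_pos s
    have := Real.exp_pos (-s)
    rw [abs_le]; constructor <;> linarith
  have := (h1.const_mul W).add ((gauss_integrable d M hM).const_mul (d * I))
  refine this.congr (Filter.Eventually.of_forall fun s => ?_)
  simp only [Pi.add_apply]
  ring

lemma gauss_integral1 (d M : ℝ) (hM : 0 < M) :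
    ∫ s : ℝ, (W * s + d * I) * Complex.exp (-(Real.pi * I / M) * (W * s + d * I) ^ 2) = 0 := by
  have hMc : (M : ℂ) ≠ 0 := by exact_mod_cast hM.ne'
  have hpi : (Real.pi : ℂ) ≠ 0 := by exact_mod_cast Real.pi_ne_zero
  have hW := W_ne
  have hd : ∀ s : ℝ, HasDerivAt
      (fun s : ℝ => Complex.exp (-(Real.pi * I / M) * (W * s + d * I) ^ 2))
      ((-(Real.pi * I / M) * 2 * W) * ((W * s + d * I) *
        Complex.exp (-(Real.pi * I / M) * (W * s + d * I) ^ 2))) s := by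
    intro s
    have h1 : HasDerivAt (fun s : ℝ => W * (s : ℂ) + d * I) (W * 1) s :=
      ((((hasDerivAt_id s).ofReal_comp).const_mul W).add_const _)
    have h2 := ((h1.pow 2).const_mul (-(Real.pi * I / M) : ℂ)).cexp
    refine h2.congr_deriv ?_
    simp only [Pi.pow_apply]
    push_cast
    ring
  have := MeasureTheory.integral_eq_zero_of_hasDerivAt_of_integrable hd
    ((gauss_integrable1 d M hM).const_mul _) (gauss_integrable d M hM)
  rw [MeasureTheory.integral_const_mul] at this
  rcases mul_eq_zero.1 this with h | h
  · exfalso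
    revert h
    simp [hMc, hW]
  · exact h

/-- the integrand for the Gauss-sum type identity -/
noncomputable def EE (M : ℝ) (x : ℂ) : ℂ :=
  Complex.exp (-(Real.pi * I / M) * x ^ 2) * (x / (I * M) - 1 / 2)

lemma EE_good (p M d : ℝ) (hp : 0 < p) (hM : 0 < M) (hd : 0 ≤ d) :
    Good p (fun x => EE M (x + d * I)) := by
  have := good_gauss p hp (Polynomial.C (1 / (I * M)) * (Polynomial.X + Polynomial.C (d * I))
    - Polynomial.C (1 / 2)) d M hd hM
  convert this using 2 with x
  simp only [EE, Polynomial.eval_sub, Polynomial.eval_mul, Polynomial.eval_C, Polynomial.eval_add,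
    Polynomial.eval_X]
  ring

lemma tele (p a : ℤ) (ha : 0 < a) (hap : a < p) (N : ℕ) (hN : 0 < N) :
    (∫ s : ℝ, EE (2 * p * N : ℝ) (W * s) * hh p a (W * s)) -
      (∫ s : ℝ, EE (2 * p * N : ℝ) (W * s + (2 * p * N : ℝ) * I) * hh p a (W * s)) =
      -(2 * I * p / W) * PsiTilde p a N := by
  have hp0 : 0 < p := ha.trans hap
  have hp : (0 : ℝ) < p := by exact_mod_cast hp0
  have hpc : (p : ℂ) ≠ 0 := by exact_mod_cast hp.ne'
  have haR : (0 : ℝ) < a := by exact_mod_cast ha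
  have hapR : (a : ℝ) < p := by exact_mod_cast hap
  have hNR : (0 : ℝ) < N := by exact_mod_cast hN
  have hNc : (N : ℂ) ≠ 0 := by exact_mod_cast hNR.ne'
  set M : ℝ := 2 * p * N with hM
  have hMp : 0 < M := by positivity
  set f : ℤ → ℂ := fun k => EE M (k * I) with hf
  set A : ℕ → ℂ := fun m => ∫ s : ℝ, EE M (W * s + (2 * p * m : ℝ) * I) * hh p a (W * s) with hA
  have hstep : ∀ m : ℕ, A m - A (m + 1) =
      2 * I * p / W * (f (a + 2 * p * m) - f (2 * p - a + 2 * p * m)) := by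
    intro m
    have := master (EE_good p M (2 * p * m) hp hMp (by positivity)) a hp haR (by linarith)
    simp only [hA, hf]
    have k1 : ((a + 2 * p * m : ℤ) : ℂ) * I = (a : ℝ) * I + (2 * p * m : ℝ) * I := by
      push_cast; ring
    have k2 : ((2 * p - a + 2 * p * m : ℤ) : ℂ) * I =
        (2 * p - a : ℝ) * I + (2 * p * m : ℝ) * I := by
      push_cast; ring
    rw [k1, k2]
    convert this using 2
    · apply MeasureTheory.integral_congr_ae
      refine Filter.Eventually.of_forall fun s => ?_
      simp only
      congr 2
      push_cast
      ring
    · simp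
  have htel := Finset.sum_range_sub' A N
  have hAN : A N = ∫ s : ℝ, EE M (W * s + M * I) * hh p a (W * s) := by
    simp only [hA, hM]
  have hA0 : A 0 = ∫ s : ℝ, EE M (W * s) * hh p a (W * s) := by
    simp only [hA]; simp
  rw [← hAN, ← hA0, ← htel, Finset.sum_congr rfl (fun m _ => hstep m), ← Finset.mul_sum,
    ← psi_sum p a ha hap, PsiTilde, mul_neg, neg_mul, neg_neg]
  congr 1
  apply Finset.sum_congr rfl
  intro k _
  rw [mul_assoc]
  congr 1
  simp only [hf, EE]
  have e1 : -(Real.pi * I / (M : ℂ)) * ((k : ℂ) * I) ^ 2 =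
      Real.pi * I * (k : ℂ) ^ 2 / (2 * p * N) := by
    rw [mul_pow, I_sq, hM]; push_cast; ring
  have e2 : (k : ℂ) * I / (I * M) = (k : ℂ) / (2 * p * N) := by
    have := I_ne_zero
    rw [hM]; push_cast; field_simp
  rw [e1, e2]

lemma geom_hh (P : ℕ) (hP : 0 < P) (a : ℤ) (ha : 0 < a) (hap : a < P) (s : ℝ) :
    (1 - Complex.exp (2 * Real.pi * (W * s))) * hh P a (W * s) =
      2 * I * ∑ b ∈ Finset.range (2 * P), (Real.sin ((a : ℝ) * b * Real.pi / P) : ℂ) *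
        Complex.exp (Real.pi * b * (W * s) / P) := by
  have hp : (0 : ℝ) < P := by exact_mod_cast hP
  have hpc : (P : ℂ) ≠ 0 := by exact_mod_cast hp.ne'
  have haR : (0 : ℝ) < a := by exact_mod_cast ha
  have hapR : (a : ℝ) < P := by exact_mod_cast hap
  set y := Complex.exp (Real.pi * (W * s) / P) with hy
  set ζ := Complex.exp (Real.pi * a / P * I) with hζ
  have hζ0 : ζ ≠ 0 := Complex.exp_ne_zero _
  have hζ1 : ζ ^ (2 * P) = 1 := by
    rw [hζ, ← Complex.exp_nat_mul, Complex.exp_eq_one_iff]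
    refine ⟨a, ?_⟩
    push_cast; field_simp
  have hy1 : Complex.exp (2 * Real.pi * (W * s)) = y ^ (2 * P) := by
    rw [hy, ← Complex.exp_nat_mul]
    congr 1
    push_cast; field_simp
  have n1 : y * ζ⁻¹ - 1 ≠ 0 := by
    have := ph_ne P hp a haR (by linarith) s (by simp) (by simp) (by simp)
    rw [hy, hζ, ← Complex.exp_neg, ← Complex.exp_add]
    convert this using 3
    push_cast; field_simp; ring
  have n2 : y * ζ - 1 ≠ 0 := by
    have := ph_ne P hp (2 * P - a) (by linarith) (by linarith) s (by simp) (by simp) (by simp)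
    rw [hy, hζ, ← Complex.exp_add]
    rw [← Complex.exp_periodic] at this
    convert this using 3
    push_cast; field_simp; ring
  have f1 := ph_fst P a (W * s)
  have f2 := ph_snd P a hp (W * s)
  have f1' : ph P (W * s - (a : ℝ) * I) = 1 / (y * ζ⁻¹ - 1) := by
    rw [f1, hy, hζ]; push_cast; rfl
  have f2' : ph P (W * s - (2 * (P : ℝ) - (a : ℝ) : ℝ) * I) = 1 / (y * ζ - 1) := by
    rw [f2, hy, hζ]; push_cast; rfl
  have g1 := mul_geom_sum (y * ζ⁻¹) (2 * P)
  have g2 := mul_geom_sum (y * ζ) (2 * P)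
  have hζ2 : ζ⁻¹ ^ (2 * P) = 1 := by rw [inv_pow, hζ1, inv_one]
  rw [mul_pow, hζ1, mul_one] at g2
  rw [mul_pow, hζ2, mul_one] at g1
  have h1 : (1 - y ^ (2 * P)) * (1 / (y * ζ⁻¹ - 1)) = -∑ i ∈ Finset.range (2 * P), (y * ζ⁻¹) ^ i := by
    rw [mul_one_div, div_eq_iff n1]; linear_combination g1
  have h2 : (1 - y ^ (2 * P)) * (1 / (y * ζ - 1)) = -∑ i ∈ Finset.range (2 * P), (y * ζ) ^ i := by
    rw [mul_one_div, div_eq_iff n2]; linear_combination g2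
  rw [hh, f1', f2', hy1, mul_sub, h1, h2, neg_sub_neg, ← Finset.sum_sub_distrib, Finset.mul_sum]
  apply Finset.sum_congr rfl
  intro b _
  have e1 : Complex.exp (Real.pi * b * (W * s) / P) = y ^ b := by
    rw [hy, ← Complex.exp_nat_mul]; congr 1; ring
  have e2 : ζ ^ b = Complex.exp (((a : ℂ) * b * Real.pi / P) * I) := by
    rw [hζ, ← Complex.exp_nat_mul]; congr 1; ring
  have e3 : ζ⁻¹ ^ b = Complex.exp (-((a : ℂ) * b * Real.pi / P) * I) := by
    rw [inv_pow, e2, ← Complex.exp_neg]; congr 1; ring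
  rw [e1, mul_pow, mul_pow, e2, e3]
  push_cast
  rw [Complex.sin]
  linear_combination (-(Complex.exp (-((a : ℂ) * b * Real.pi / P) * I) - Complex.exp (((a : ℂ) * b * Real.pi / P) * I)) * y ^ b) * I_sq

/-- the Gauss-sum term -/
noncomputable def TT (P : ℕ) (a : ℤ) (N : ℕ) (b : ℕ) : ℂ :=
  (Real.sin ((a : ℝ) * b * Real.pi / P) : ℂ) * (1 - (b : ℂ) / P) *
    Complex.exp (-(Real.pi * I * (b : ℂ) ^ 2 * N / (2 * P)))

lemma lin_gauss_aux (d M : ℝ) (hM : 0 < M) :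
    (MeasureTheory.Integrable fun s : ℝ =>
      Complex.exp (-(Real.pi * I / M) * (W * s + d * I) ^ 2) * ((W * s) / (I * M) + 1 / 2)) ∧
    ∫ s : ℝ, Complex.exp (-(Real.pi * I / M) * (W * s + d * I) ^ 2) * ((W * s) / (I * M) + 1 / 2) =
      (1 / 2 - d / M) * (√M : ℝ) := by
  have hMc : (M : ℂ) ≠ 0 := by exact_mod_cast hM.ne'
  have hI := I_ne_zero
  have e : ∀ s : ℝ, Complex.exp (-(Real.pi * I / M) * (W * s + d * I) ^ 2) *
      ((W * s) / (I * M) + 1 / 2) =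
      (1 / (I * M)) * ((W * s + d * I) * Complex.exp (-(Real.pi * I / M) * (W * s + d * I) ^ 2)) +
      (1 / 2 - d / M) * Complex.exp (-(Real.pi * I / M) * (W * s + d * I) ^ 2) := by
    intro s
    field_simp
    ring
  have i1 := (gauss_integrable1 d M hM).const_mul (1 / (I * M))
  have i2 := (gauss_integrable d M hM).const_mul ((1 : ℂ) / 2 - d / M)
  simp_rw [e]
  refine ⟨i1.add i2, ?_⟩
  rw [MeasureTheory.integral_add i1 i2, MeasureTheory.integral_const_mul,
    MeasureTheory.integral_const_mul, gauss_integral1 d M hM, gauss_integral d M hM]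
  ring

lemma main_identity (P : ℕ) (a : ℤ) (ha : 0 < a) (hap : a < P) (N : ℕ) (hN : 0 < N) :
    ∫ s : ℝ, Complex.exp (-(Real.pi * I / (2 * P * N : ℝ)) * (W * s) ^ 2) * hh P a (W * s) =
      2 * I * P / W * PsiTilde P a N +
        I * (√(2 * P * N) : ℝ) * ∑ b ∈ Finset.range (2 * P), TT P a N b := by
  have hP : 0 < P := by
    have : (0 : ℤ) < P := ha.trans hap
    exact_mod_cast this
  have hp : (0 : ℝ) < P := by exact_mod_cast hP
  have hpc : (P : ℂ) ≠ 0 := by exact_mod_cast hp.ne'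
  have haR : (0 : ℝ) < a := by exact_mod_cast ha
  have hapR : (a : ℝ) < P := by exact_mod_cast hap
  have hNR : (0 : ℝ) < N := by exact_mod_cast hN
  have hNc : (N : ℂ) ≠ 0 := by exact_mod_cast hNR.ne'
  have hI := I_ne_zero
  have ht := tele P a ha hap N hN
  simp only [Int.cast_natCast] at ht
  set M : ℝ := 2 * P * N with hM
  have hMp : 0 < M := by positivity
  have hMc : (M : ℂ) ≠ 0 := by exact_mod_cast hMp.ne'
  have i0 : MeasureTheory.Integrable fun s : ℝ => EE M (W * s) * hh P a (W * s) := by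
    have := (EE_good P M 0 hp hMp le_rfl).integrable a hp haR (by linarith)
    simpa using this
  have i1 : MeasureTheory.Integrable fun s : ℝ => EE M (W * s + M * I) * hh P a (W * s) :=
    (EE_good P M M hp hMp hMp.le).integrable a hp haR (by linarith)
  have i2 : MeasureTheory.Integrable fun s : ℝ =>
      Complex.exp (-(Real.pi * I / M) * (W * s) ^ 2) * hh P a (W * s) := by
    have := (good_gauss P hp 1 0 M le_rfl hMp).integrable a hp haR (by linarith)
    simpa using this
  have key : ∀ s : ℝ, EE M (W * s) * hh P a (W * s) - EE M (W * s + M * I) * hh P a (W * s) =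
      (∑ b ∈ Finset.range (2 * P), (2 * I * (Real.sin ((a : ℝ) * b * Real.pi / P) : ℂ) *
        Complex.exp (-(Real.pi * I * (b : ℂ) ^ 2 * N / (2 * P)))) *
        (Complex.exp (-(Real.pi * I / M) * (W * s + (N * b : ℝ) * I) ^ 2) *
          ((W * s) / (I * M) + 1 / 2))) -
      Complex.exp (-(Real.pi * I / M) * (W * s) ^ 2) * hh P a (W * s) := by
    intro s
    have hg := geom_hh P hP a ha hap s
    have e1 : EE M (W * s + M * I) = Complex.exp (-(Real.pi * I / M) * (W * s) ^ 2) *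
        Complex.exp (2 * Real.pi * (W * s)) * ((W * s) / (I * M) + 1 / 2) := by
      rw [EE, ← Complex.exp_add]
      congr 1
      · rw [Complex.exp_eq_exp_iff_exists_int]
        refine ⟨P * N, ?_⟩
        rw [show (W * (s : ℂ) + M * I) ^ 2 = (W * s) ^ 2 + 2 * W * s * M * I + M ^ 2 * (I ^ 2) by ring,
          I_sq]
        have : ((P * N : ℤ) : ℂ) * (2 * Real.pi * I) = Real.pi * I * M := by
          rw [hM]; push_cast; ring
        rw [this]
        field_simp
        linear_combination (-(2 * W * s * M) : ℂ) * I_sq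
      · field_simp; ring
    have e2 : ∀ b : ℕ, Complex.exp (-(Real.pi * I * (b : ℂ) ^ 2 * N / (2 * P))) *
        Complex.exp (-(Real.pi * I / M) * (W * s + (N * b : ℝ) * I) ^ 2) =
        Complex.exp (-(Real.pi * I / M) * (W * s) ^ 2) *
          Complex.exp (Real.pi * b * (W * s) / P) := by
      intro b
      rw [← Complex.exp_add, ← Complex.exp_add]
      congr 1
      rw [show (W * (s : ℂ) + (N * b : ℝ) * I) ^ 2 = (W * s) ^ 2 + 2 * W * s * (N * b : ℝ) * I +
        (N * b : ℝ) ^ 2 * (I ^ 2) by ring, I_sq, hM]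
      push_cast
      field_simp
      linear_combination (-(2 * W * s * b * N) : ℂ) * I_sq
    have e3 : ∑ b ∈ Finset.range (2 * P), (2 * I * (Real.sin ((a : ℝ) * b * Real.pi / P) : ℂ) *
        Complex.exp (-(Real.pi * I * (b : ℂ) ^ 2 * N / (2 * P)))) *
        (Complex.exp (-(Real.pi * I / M) * (W * s + (N * b : ℝ) * I) ^ 2) *
          ((W * s) / (I * M) + 1 / 2)) =
        Complex.exp (-(Real.pi * I / M) * (W * s) ^ 2) * ((W * s) / (I * M) + 1 / 2) *
        (2 * I * ∑ b ∈ Finset.range (2 * P), (Real.sin ((a : ℝ) * b * Real.pi / P) : ℂ) *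
        Complex.exp (Real.pi * b * (W * s) / P)) := by
      rw [Finset.mul_sum, Finset.mul_sum]
      apply Finset.sum_congr rfl
      intro b _
      linear_combination (2 * I * (Real.sin ((a : ℝ) * b * Real.pi / P) : ℂ) *
        ((W * s) / (I * M) + 1 / 2)) * e2 b
    rw [e3, ← hg, e1, EE]
    ring
  rw [← MeasureTheory.integral_sub i0 i1] at ht
  simp_rw [key] at ht
  rw [MeasureTheory.integral_sub _ i2, MeasureTheory.integral_finsetSum] at ht
  rotate_left
  · intro b _
    exact (lin_gauss_aux (N * b) M hMp).1.const_mul _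
  · apply MeasureTheory.integrable_finsetSum
    intro b _
    exact (lin_gauss_aux (N * b) M hMp).1.const_mul _
  have e4 : ∑ b ∈ Finset.range (2 * P), (∫ s : ℝ, (2 * I * (Real.sin ((a : ℝ) * b * Real.pi / P) : ℂ) *
        Complex.exp (-(Real.pi * I * (b : ℂ) ^ 2 * N / (2 * P)))) *
        (Complex.exp (-(Real.pi * I / M) * (W * s + (N * b : ℝ) * I) ^ 2) *
          ((W * s) / (I * M) + 1 / 2))) =
      I * (√M : ℝ) * ∑ b ∈ Finset.range (2 * P), TT P a N b := by
    rw [Finset.mul_sum]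
    apply Finset.sum_congr rfl
    intro b _
    rw [MeasureTheory.integral_const_mul, (lin_gauss_aux (N * b) M hMp).2, TT]
    have : ((N * b : ℝ) : ℂ) / M = b / (2 * P) := by
      rw [hM]; push_cast; field_simp
    rw [this]
    field_simp
    try ring
  rw [e4] at ht
  linear_combination -ht

lemma TT_sym (P : ℕ) (hP : 0 < P) (a : ℤ) (N : ℕ) (b : ℕ) (hb : b ≤ 2 * P) :
    TT P a N (2 * P - b) = TT P a N b := by
  have hp : (0 : ℝ) < P := by exact_mod_cast hP
  have hpc : (P : ℂ) ≠ 0 := by exact_mod_cast hp.ne'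
  have e1 : Real.sin ((a : ℝ) * ((2 * P - b : ℕ) : ℝ) * Real.pi / P) =
      -Real.sin ((a : ℝ) * b * Real.pi / P) := by
    rw [Nat.cast_sub hb]
    rw [show (a : ℝ) * (((2 * P : ℕ) : ℝ) - b) * Real.pi / P =
      -((a : ℝ) * b * Real.pi / P) + a * (2 * Real.pi) by push_cast; field_simp; ring,
      Real.sin_add_int_mul_two_pi, Real.sin_neg]
  have e2 : Complex.exp (-(Real.pi * I * ((2 * P - b : ℕ) : ℂ) ^ 2 * N / (2 * P))) =
      Complex.exp (-(Real.pi * I * (b : ℂ) ^ 2 * N / (2 * P))) := by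
    rw [Complex.exp_eq_exp_iff_exists_int]
    refine ⟨N * (b - P), ?_⟩
    rw [Nat.cast_sub hb]
    push_cast
    field_simp
    ring
  rw [TT, TT, e1, e2, Nat.cast_sub hb]
  push_cast
  field_simp
  ring

lemma TT_sum (m : ℕ) (a : ℤ) (N : ℕ) :
    ∑ b ∈ Finset.range (2 * (m + 1)), TT (m + 1) a N b =
      2 * ∑ b ∈ Finset.range m, TT (m + 1) a N (b + 1) := by
  have h0 : TT (m + 1) a N 0 = 0 := by simp [TT]
  have hm : TT (m + 1) a N (m + 1) = 0 := by
    have : ((m + 1 : ℕ) : ℂ) ≠ 0 := by exact_mod_cast Nat.succ_ne_zero m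
    rw [TT, div_self this]; simp
  rw [show 2 * (m + 1) = (m + 1 + 1) + m by ring, Finset.sum_range_add, Finset.sum_range_succ,
    Finset.sum_range_succ', h0, hm, add_zero, add_zero, two_mul]
  congr 1
  rw [← Finset.sum_range_reflect]
  apply Finset.sum_congr rfl
  intro b hb
  rw [Finset.mem_range] at hb
  rw [← TT_sym (m + 1) (by omega) a N (b + 1) (by omega)]
  congr 1
  omega

lemma Icc_sum (m : ℕ) (f : ℤ → ℂ) :
    ∑ b ∈ Finset.Icc (1 : ℤ) m, f b = ∑ b ∈ Finset.range m, f ((b + 1 : ℕ) : ℤ) := by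
  induction m with
  | zero => simp
  | succ n ih =>
    rw [Finset.sum_range_succ, ← ih]
    have : Finset.Icc (1 : ℤ) ((n + 1 : ℕ) : ℤ) = insert ((n + 1 : ℕ) : ℤ) (Finset.Icc (1 : ℤ) n) := by
      ext k
      simp only [Finset.mem_insert, Finset.mem_Icc]
      push_cast
      omega
    rw [this, Finset.sum_insert (by simp), add_comm]

lemma sqrt_NI (N : ℕ) (hN : 0 < N) : ((N : ℂ) / I) ^ ((1 : ℂ) / 2) = (√N : ℝ) * W := by
  have hNR : (0 : ℝ) < N := by exact_mod_cast hN
  have h1 : (N : ℂ) / I = ((√N : ℝ) * W) ^ 2 := by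
    rw [mul_pow, W_sq, ← Complex.ofReal_pow, Real.sq_sqrt hNR.le, Complex.div_I]
    push_cast; ring
  have h2 : 0 < (((√N : ℝ) : ℂ) * W).re := by
    have h3 := W_re 1
    rw [mul_one] at h3
    rw [Complex.re_ofReal_mul, h3]
    simp
    exact hN
  rw [h1, one_div, Complex.sq_cpow_two_inv h2]

theorem statement15 (p a : ℤ) (ha : 0 < a) (hap : a < p) (K : ℕ) :
    ∃ C : ℝ, ∀ N : ℕ, 0 < N →
      ‖PsiTilde p a N
          + ((N : ℂ) / Complex.I) ^ ((1 : ℂ) / 2) *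
            ∑ b ∈ Finset.Icc (1 : ℤ) (p - 1),
              (Real.sqrt (2 / (p : ℝ)) : ℂ) *
                (Real.sin ((a : ℝ) * (b : ℝ) * Real.pi / (p : ℝ)) : ℂ) *
                (1 - (b : ℂ) / (p : ℂ)) *
                Complex.exp (-(Real.pi * Complex.I * (b : ℂ) ^ 2 * (N : ℂ) / (2 * p)))
          - ∑ k ∈ Finset.range (K + 1),
              Lval p a (2 * k) / (Nat.factorial k : ℂ) *
                (Real.pi * Complex.I / (2 * p * N)) ^ k‖
        ≤ C / (N : ℝ) ^ (K + 1) := by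
  have hp0 : 0 < p := ha.trans hap
  obtain ⟨m, rfl⟩ : ∃ m : ℕ, p = ((m + 1 : ℕ) : ℤ) := ⟨(p - 1).toNat, by omega⟩
  obtain ⟨C, hC⟩ := asymp ((m + 1 : ℕ) : ℤ) a ha hap K
  set P : ℕ := m + 1 with hPdef
  have hp : (0 : ℝ) < P := by exact_mod_cast hp0
  have hpc : (P : ℂ) ≠ 0 := by exact_mod_cast hp.ne'
  have hW := W_ne
  have hI := I_ne_zero
  refine ⟨C / (2 * P), fun N hN => ?_⟩
  have hNR : (0 : ℝ) < N := by exact_mod_cast hN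
  have hNc : (N : ℂ) ≠ 0 := by exact_mod_cast hNR.ne'
  have hCN := hC N hN
  simp_rw [moment (P : ℤ) a ha hap] at hCN
  simp only [Int.cast_natCast] at hCN ⊢
  rw [main_identity P a ha hap N hN] at hCN
  have hS : ∑ b ∈ Finset.Icc (1 : ℤ) ((P : ℤ) - 1),
      (Real.sqrt (2 / (P : ℝ)) : ℂ) * (Real.sin ((a : ℝ) * (b : ℝ) * Real.pi / (P : ℝ)) : ℂ) *
        (1 - (b : ℂ) / (P : ℂ)) *
        Complex.exp (-(Real.pi * Complex.I * (b : ℂ) ^ 2 * (N : ℂ) / (2 * P))) =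
      (Real.sqrt (2 / (P : ℝ)) : ℂ) * ∑ b ∈ Finset.range m, TT P a N (b + 1) := by
    rw [show ((P : ℤ) - 1) = (m : ℤ) by rw [hPdef]; push_cast; ring, Icc_sum, Finset.mul_sum]
    apply Finset.sum_congr rfl
    intro b _
    rw [TT]
    simp only [Int.cast_natCast]
    ring
  rw [hS, sqrt_NI N hN]
  have hsq : (√(2 * P * N) : ℝ) = P * √(2 / P) * √N := by
    rw [Real.sqrt_mul (by positivity)]
    congr 1
    rw [Real.sqrt_eq_iff_mul_self_eq (by positivity) (by positivity), mul_mul_mul_comm,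
      Real.mul_self_sqrt (by positivity)]
    field_simp
  have hTs := TT_sum m a N
  rw [← hPdef] at hTs
  have hfin : ∀ X : ℂ, ‖X‖ = ‖2 * I * P / W * X‖ / (2 * P) := by
    intro X
    rw [norm_mul, norm_div, norm_W, norm_mul, norm_mul, Complex.norm_I, Complex.norm_natCast]
    simp
    try field_simp
  rw [hfin, div_right_comm]
  gcongr
  refine le_of_eq_of_le (congrArg _ ?_) hCN
  rw [hTs, hsq, mul_sub, mul_add]
  congr 1
  · congr 1
    push_cast
    field_simp
  · rw [Finset.mul_sum]
    apply Finset.sum_congr rfl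
    intro k _
    have : (-(Real.pi * I / ((2 * P * N : ℝ) : ℂ))) ^ k =
        (-1) ^ k * (Real.pi * I / (2 * P * N)) ^ k := by
      rw [neg_pow]; push_cast; ring
    rw [this]
    have h1 : ((-1 : ℂ) ^ k) * (-1) ^ k = 1 := by rw [← mul_pow]; simp
    linear_combination (-(2 * I * P / W * (Lval P a (2 * k) / (Nat.factorial k : ℂ) *
      (Real.pi * I / (2 * P * N)) ^ k))) * h1
end
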